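/- arXiv:2409.10745 — 5 statements merged into one kernel-verified Lean document; each statement's English description precedes it below -/
import Mathlib

section
/- Let (X,G,α) be a topological dynamical system and (x_1,…,x_k) a tuple in X^k \ Δ_k(X) with k ≥ 2. Then (x_1,…,x_k) is a sequence entropy tuple if and only if it is an IN-tuple. -/
open Filter Topology Set
open scoped ENNReal Classical

section EntropyDefs

variable {G X : Type*}

/-- `𝒰` is an open cover of `X`. -/
def IsOpenCover [TopologicalSpace X] (𝒰 : Set (Set X)) : Prop :=
  (∀ U ∈ 𝒰, IsOpen U) ∧ ⋃₀ 𝒰 = Set.univ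

/-- `N(𝒰)`: the minimal cardinality of a finite subcover of `𝒰`
(junk value `0` if no finite subcover exists). -/
noncomputable def coverN (𝒰 : Set (Set X)) : ℕ :=
  sInf {n : ℕ | ∃ F : Finset (Set X), ↑F ⊆ 𝒰 ∧ F.card = n ∧ ⋃₀ (F : Set (Set X)) = Set.univ}

/-- The join `⋁_{i=1}^n α_{g_i⁻¹}(𝒰)` of the covers `α_{g_i⁻¹}(𝒰) = (α g_i)⁻¹'(𝒰)`. -/
def joinPull (α : G → X → X) (𝒰 : Set (Set X)) {n : ℕ} (g : Fin n → G) : Set (Set X) :=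
  {V | ∃ U : Fin n → Set X, (∀ i, U i ∈ 𝒰) ∧ V = ⋂ i, α (g i) ⁻¹' U i}

/-- Topological sequence entropy of the cover `𝒰` along the sequence `𝔰`:
`h_top^𝔰(𝒰,G) = limsup_n (1/n) log N(⋁_{i=1}^n α_{𝔰(i)⁻¹}(𝒰))`, valued in `[0,∞]`. -/
noncomputable def seqEntCover (α : G → X → X) (𝔰 : ℕ → G) (𝒰 : Set (Set X)) : ℝ≥0∞ :=
  Filter.atTop.limsup fun n : ℕ =>
    ENNReal.ofReal (Real.log (coverN (joinPull α 𝒰 fun i : Fin n => 𝔰 i)) / n)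

/-- Topological sequence entropy of the action along `𝔰`: supremum over all open covers. -/
noncomputable def seqEnt [TopologicalSpace X] (α : G → X → X) (𝔰 : ℕ → G) : ℝ≥0∞ :=
  ⨆ 𝒰 ∈ {𝒰 : Set (Set X) | IsOpenCover 𝒰}, seqEntCover α 𝔰 𝒰

/-- `p*_{X,G,𝒰}(n) = max_{(g_1,…,g_n) ∈ Gⁿ} N(⋁_{i=1}^n α_{g_i⁻¹}(𝒰))`. -/
noncomputable def patN (α : G → X → X) (𝒰 : Set (Set X)) (n : ℕ) : ℕ :=
  sSup {m : ℕ | ∃ g : Fin n → G, m = coverN (joinPull α 𝒰 g)}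

/-- Maximal pattern entropy of the cover `𝒰`: `lim_n (1/n) log p*_{X,G,𝒰}(n)`
(the limit exists by subadditivity and coincides with the limsup used here). -/
noncomputable def patEntCover (α : G → X → X) (𝒰 : Set (Set X)) : ℝ≥0∞ :=
  Filter.atTop.limsup fun n : ℕ => ENNReal.ofReal (Real.log (patN α 𝒰 n) / n)

/-- Maximal pattern entropy `h*_top(X,G)`: supremum over all open covers. -/
noncomputable def patEnt [TopologicalSpace X] (α : G → X → X) : ℝ≥0∞ :=
  ⨆ 𝒰 ∈ {𝒰 : Set (Set X) | IsOpenCover 𝒰}, patEntCover α 𝒰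

/-- `α` is an action of `G` on `X` by homeomorphisms. -/
def IsActionBy [Group G] [TopologicalSpace X] (α : G → X → X) : Prop :=
  (∀ x, α 1 x = x) ∧ (∀ g h x, α (g * h) x = α g (α h x)) ∧ ∀ g, Continuous (α g)

/-- `I ⊆ G` is an independence set for the tuple `(A 1, …, A k)`:
for every nonempty finite `F ⊆ I` and every `ω : F → {1,…,k}` we have
`⋂_{g ∈ F} α_{g⁻¹}(A (ω g)) ≠ ∅`. -/
def IsIndepSet (α : G → X → X) {k : ℕ} (A : Fin k → Set X) (I : Set G) : Prop :=
  ∀ F : Finset G, ↑F ⊆ I → F.Nonempty → ∀ ω : G → Fin k,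
    (⋂ g ∈ F, α g ⁻¹' A (ω g)).Nonempty

/-- The tuple `(A 1, …, A k)` has arbitrarily large finite independence sets. -/
def HasArbLargeIndep (α : G → X → X) {k : ℕ} (A : Fin k → Set X) : Prop :=
  ∀ n : ℕ, ∃ F : Finset G, n ≤ F.card ∧ IsIndepSet α A ↑F

/-- `(x 1, …, x k)` is an IN-tuple: every product neighbourhood has arbitrarily large
finite independence sets. -/
def IsINTuple [TopologicalSpace X] (α : G → X → X) {k : ℕ} (x : Fin k → X) : Prop :=
  ∀ U : Fin k → Set X, (∀ i, IsOpen (U i)) → (∀ i, x i ∈ U i) → HasArbLargeIndep α U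

/-- The action `α` of `G` on `X` is (topologically) weak-mixing. -/
def IsWeakMixing [TopologicalSpace X] (α : G → X → X) : Prop :=
  ∀ U₁ U₂ V₁ V₂ : Set X, IsOpen U₁ → IsOpen U₂ → IsOpen V₁ → IsOpen V₂ →
    U₁.Nonempty → U₂.Nonempty → V₁.Nonempty → V₂.Nonempty →
    ∃ g : G, (U₁ ∩ α g '' V₁).Nonempty ∧ (U₂ ∩ α g '' V₂).Nonempty

/-- `(x₁,x₂)` is a sequence entropy pair. -/
def IsSeqEntropyPair [TopologicalSpace X] (α : G → X → X) (x₁ x₂ : X) : Prop :=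
  x₁ ≠ x₂ ∧ ∀ A₁ A₂ : Set X, IsClosed A₁ → IsClosed A₂ →
    A₁ ∈ nhds x₁ → A₂ ∈ nhds x₂ → Disjoint A₁ A₂ →
    ∃ 𝔰 : ℕ → G, 0 < seqEntCover α 𝔰 {A₁ᶜ, A₂ᶜ}

/-- `(x 1, …, x k)` is a sequence entropy tuple: it is not diagonal, and whenever
`U i` are closed neighbourhoods of the `x i` which coincide on equal coordinates and are
pairwise disjoint on distinct coordinates (i.e. pairwise disjoint closed neighbourhoods of
the distinct points of the tuple), some sequence gives positive sequence entropy for the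
cover by their complements. -/
def IsSeqEntropyTuple [TopologicalSpace X] (α : G → X → X) {k : ℕ} (x : Fin k → X) : Prop :=
  (∃ i j, x i ≠ x j) ∧ ∀ U : Fin k → Set X,
    (∀ i, IsClosed (U i)) → (∀ i, U i ∈ nhds (x i)) →
    (∀ i j, x i = x j → U i = U j) → (∀ i j, x i ≠ x j → Disjoint (U i) (U j)) →
    ∃ 𝔰 : ℕ → G, 0 < seqEntCover α 𝔰 (Set.range fun i => (U i)ᶜ)

end EntropyDefs

namespace CoInd

variable {G : Type*} [Group G] (H : Subgroup G)

/-- `H\G`, the space of right cosets of `H` in `G`. -/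
abbrev RQ := Quotient (QuotientGroup.rightRel H)

/-- Right multiplication `Hg ↦ H(g·g₀)` on the right coset space. -/
def rmul (g₀ : G) : RQ H → RQ H :=
  Quotient.map' (fun g => g * g₀) (fun a b hab => by
    rw [QuotientGroup.rightRel_apply] at hab ⊢
    have h2 : b * g₀ * (a * g₀)⁻¹ = b * a⁻¹ := by group
    rw [h2]; exact hab)

/-- `s : H\G → G` is a section of the right cosets with `s(H) = e`. -/
def IsSection (s : RQ H → G) : Prop :=
  (∀ θ : RQ H, Quotient.mk'' (s θ) = θ) ∧ s (Quotient.mk'' 1) = 1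

variable {X : Type*}

/-- The co-induced action `α^{H\G}` of `G` on `X_H^G = ∏_{θ ∈ H\G} X`, relative to a
section `s` of the right cosets:
`(α^{H\G}_{g₀} f)(Hg) = α_{s(Hg)·g₀·s(Hg·g₀)⁻¹} (f (Hg·g₀))`.
(When `s` is a genuine section the element `s(Hg)·g₀·s(Hg·g₀)⁻¹` always lies in `H`,
so the `else` branch is never taken.) -/
noncomputable def coindAct (α : ↥H → X → X) (s : RQ H → G) (g₀ : G)
    (f : RQ H → X) : RQ H → X := fun θ =>
  if h : s θ * g₀ * (s (rmul H g₀ θ))⁻¹ ∈ H then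
    α ⟨s θ * g₀ * (s (rmul H g₀ θ))⁻¹, h⟩ (f (rmul H g₀ θ))
  else f (rmul H g₀ θ)

end CoInd

/-- The family `A` of `ι`-tuples of subsets, indexed by `τ`, is independent along `W` inside `S`:
every `ι`-colouring of `W` is realized by a point of `S`. -/
def ShattersOn {X τ ι : Type*} (A : τ → ι → Set X) (S : Set X) (W : Finset τ) : Prop :=
  ∀ ω : τ → ι, ∃ x ∈ S, ∀ z ∈ W, x ∈ A z (ω z)

/-- The subsets of `Z` along which `A` is independent inside `S`. -/
noncomputable def shatteredSets {X τ ι : Type*} (A : τ → ι → Set X) (S : Set X)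
    (Z : Finset τ) : Finset (Finset τ) :=
  Z.powerset.filter (ShattersOn A S)

section Combinatorics

variable {X τ ι : Type*} {A : τ → ι → Set X}

lemma ShattersOn.mono {S T : Set X} (h : S ⊆ T) {W : Finset τ} (hW : ShattersOn A S W) :
    ShattersOn A T W := fun ω => by
  obtain ⟨x, hx, hxW⟩ := hW ω
  exact ⟨x, h hx, hxW⟩

lemma mem_shatteredSets {S : Set X} {Z W : Finset τ} :
    W ∈ shatteredSets A S Z ↔ W ⊆ Z ∧ ShattersOn A S W := by
  simp [shatteredSets]

lemma shatteredSets_mono {S T : Set X} {Z Z' : Finset τ} (hS : S ⊆ T) (hZ : Z ⊆ Z') :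
    shatteredSets A S Z ⊆ shatteredSets A T Z' := fun W hW => by
  rw [mem_shatteredSets] at hW ⊢
  exact ⟨hW.1.trans hZ, hW.2.mono hS⟩

lemma ShattersOn.insert {S : Set X} {W : Finset τ} {z : τ}
    (h : ∀ i, ShattersOn A (S ∩ A z i) W) : ShattersOn A S (insert z W) := fun ω => by
  obtain ⟨x, hx, hxW⟩ := h (ω z) ω
  refine ⟨x, hx.1, fun y hy => ?_⟩
  rcases Finset.mem_insert.1 hy with rfl | hy
  exacts [hx.2, hxW y hy]

/-- Adding one coordinate, some colour loses a definite proportion of the shattered sets. -/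
lemma exists_card_shatteredSets_inter_le [Fintype ι] [Nontrivial ι] {S : Set X} {Z : Finset τ}
    {z : τ} (hz : z ∉ Z) :
    ∃ i, 2 * Fintype.card ι * (shatteredSets A (S ∩ A z i) Z).card ≤
      (2 * Fintype.card ι - 1) * (shatteredSets A S (insert z Z)).card := by
  by_contra! hcon
  set k := Fintype.card ι with hk
  have hk2 : 2 ≤ k := Fintype.one_lt_card
  set H := shatteredSets A S Z
  set I := H.filter (fun W => ∀ i, W ∈ shatteredSets A (S ∩ A z i) Z)
  have hsum : H.card + I.card ≤ (shatteredSets A S (insert z Z)).card := by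
    have hinj : Set.InjOn (insert z : Finset τ → Finset τ) I := by
      intro W hW W' hW' h
      have h1 : z ∉ W := fun h => hz
        ((mem_shatteredSets.1 (Finset.mem_filter.1 (Finset.mem_coe.1 hW)).1).1 h)
      have h2 : z ∉ W' := fun h => hz
        ((mem_shatteredSets.1 (Finset.mem_filter.1 (Finset.mem_coe.1 hW')).1).1 h)
      rw [← Finset.erase_insert h1, ← Finset.erase_insert h2, h]
    rw [← Finset.card_image_of_injOn hinj, ← Finset.card_union_of_disjoint]
    · refine Finset.card_le_card (Finset.union_subset
        (shatteredSets_mono subset_rfl (Finset.subset_insert _ _)) fun W hW => ?_)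
      obtain ⟨W', hW', rfl⟩ := Finset.mem_image.1 hW
      obtain ⟨hW1, hW2⟩ := Finset.mem_filter.1 hW'
      exact mem_shatteredSets.2 ⟨Finset.insert_subset_insert _ (mem_shatteredSets.1 hW1).1,
        ShattersOn.insert fun i => (mem_shatteredSets.1 (hW2 i)).2⟩
    · rw [Finset.disjoint_left]
      rintro W hW hW'
      obtain ⟨W, -, rfl⟩ := Finset.mem_image.1 hW'
      exact hz ((mem_shatteredSets.1 hW).1 (Finset.mem_insert_self _ _))
  have hsub : ∀ i, shatteredSets A (S ∩ A z i) Z ⊆ H := fun i =>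
    shatteredSets_mono inter_subset_left subset_rfl
  have hunion : H.card ≤ I.card + ∑ i, (H \ shatteredSets A (S ∩ A z i) Z).card := by
    have : H ⊆ I ∪ Finset.univ.biUnion (fun i => H \ shatteredSets A (S ∩ A z i) Z) := by
      intro W hW
      by_cases h : ∀ i, W ∈ shatteredSets A (S ∩ A z i) Z
      · exact Finset.mem_union_left _ (Finset.mem_filter.2 ⟨hW, h⟩)
      · push Not at h
        obtain ⟨i, hi⟩ := h
        exact Finset.mem_union_right _ (Finset.mem_biUnion.2
          ⟨i, Finset.mem_univ _, Finset.mem_sdiff.2 ⟨hW, hi⟩⟩)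
    exact (Finset.card_le_card this).trans ((Finset.card_union_le _ _).trans
      (Nat.add_le_add_left Finset.card_biUnion_le _))
  set h := (shatteredSets A S (insert z Z)).card
  have hHh : H.card ≤ h := by omega
  have hdiff : ∀ i, 2 * k * (H \ shatteredSets A (S ∩ A z i) Z).card < h := by
    intro i
    have h1 := hcon i
    have h2 := Finset.card_sdiff_add_card_eq_card (hsub i)
    zify [show 1 ≤ 2 * k by omega] at h1 h2 hHh ⊢
    nlinarith
  have hbound : 2 * ∑ i, (H \ shatteredSets A (S ∩ A z i) Z).card < h := by
    have h1 : ∑ i, 2 * k * (H \ shatteredSets A (S ∩ A z i) Z).card < ∑ _i : ι, h :=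
      Finset.sum_lt_sum_of_nonempty Finset.univ_nonempty fun i _ => hdiff i
    rw [← Finset.mul_sum, Finset.sum_const, Finset.card_univ, smul_eq_mul, ← hk] at h1
    refine lt_of_mul_lt_mul_left (a := k) ?_ (Nat.zero_le _)
    linarith
  obtain ⟨i⟩ : Nonempty ι := inferInstance
  have h3 : 2 * k * h < 2 * k * H.card + h := by
    have h1 := hcon i
    have h2 := Nat.mul_le_mul_left (2 * k) (Finset.card_le_card (hsub i))
    rw [Nat.sub_mul, one_mul] at h1
    omega
  have h4 : 4 * h < 4 * H.card + h := by
    nlinarith [Nat.mul_le_mul_right (h - H.card) hk2, Nat.sub_add_cancel hHh]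
  omega

/-- A Sauer–Shelah type bound for partial colourings: `S` can be covered by few sets of the form
`⋂ z ∈ Z, (A z (f z))ᶜ` when few subsets of `Z` are shattered. -/
lemma exists_small_avoiding_family [Fintype ι] [Nontrivial ι]
    (hA : ∀ z, Pairwise fun i j => Disjoint (A z i) (A z j)) {l : ℝ} (hl : 0 < l) {a : ℕ}
    (ha : (1 - 1 / (2 * Fintype.card ι) : ℝ) ^ a ≤ l) (Z : Finset τ) (S : Set X) :
    ∃ 𝓕 : Finset (τ → ι), (∀ x ∈ S, ∃ f ∈ 𝓕, ∀ z ∈ Z, x ∉ A z (f z)) ∧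
      (𝓕.card : ℝ) ≤ ((shatteredSets A S Z).card : ℝ) ^ a * (1 + l) ^ Z.card := by
  induction Z using Finset.induction_on generalizing S with
  | empty =>
    rcases S.eq_empty_or_nonempty with rfl | ⟨x, hx⟩
    · exact ⟨∅, by simp, by simp⟩
    · refine ⟨{fun _ => Classical.arbitrary ι}, by simp, ?_⟩
      have h1 : (1 : ℝ) ≤ (shatteredSets A S ∅).card := by
        exact_mod_cast Finset.card_pos.2
          ⟨∅, mem_shatteredSets.2 ⟨subset_rfl, fun _ => ⟨x, hx, by simp⟩⟩⟩
      simpa using one_le_pow₀ h1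
  | insert z Z hz ih =>
    obtain ⟨i, hi⟩ := exists_card_shatteredSets_inter_le (A := A) (S := S) hz
    obtain ⟨j, hj⟩ := exists_ne i
    obtain ⟨𝓕, hF, hFc⟩ := ih (S \ A z i)
    obtain ⟨𝓖, hG, hGc⟩ := ih (S ∩ A z i)
    refine ⟨𝓕.image (fun f => Function.update f z i) ∪ 𝓖.image (fun f => Function.update f z j),
      fun x hx => ?_, ?_⟩
    · have key : ∀ (f : τ → ι) (c : ι), x ∉ A z c → (∀ y ∈ Z, x ∉ A y (f y)) →
          ∀ y ∈ insert z Z, x ∉ A y (Function.update f z c y) := by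
        intro f c hc hf y hy
        rcases Finset.mem_insert.1 hy with rfl | hy
        · simpa using hc
        · rw [Function.update_of_ne (ne_of_mem_of_not_mem hy hz)]
          exact hf y hy
      by_cases hxi : x ∈ A z i
      · obtain ⟨f, hf, hfx⟩ := hG x ⟨hx, hxi⟩
        exact ⟨_, Finset.mem_union_right _ (Finset.mem_image_of_mem _ hf),
          key f j (fun h => Set.disjoint_left.1 (hA z hj) h hxi) hfx⟩
      · obtain ⟨f, hf, hfx⟩ := hF x ⟨hx, hxi⟩
        exact ⟨_, Finset.mem_union_left _ (Finset.mem_image_of_mem _ hf), key f i hxi hfx⟩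
    · set h := (shatteredSets A S (insert z Z)).card
      have hk0 : 0 < Fintype.card ι := Fintype.card_pos
      have h1 : ((shatteredSets A (S \ A z i) Z).card : ℝ) ≤ h := by
        exact_mod_cast Finset.card_le_card
          (shatteredSets_mono Set.sdiff_subset (Finset.subset_insert _ _))
      have h2 : ((shatteredSets A (S ∩ A z i) Z).card : ℝ) ≤
          (1 - 1 / (2 * Fintype.card ι)) * h := by
        have hi' : (2 * Fintype.card ι * (shatteredSets A (S ∩ A z i) Z).card : ℝ) ≤
            (2 * Fintype.card ι - 1) * h := by
          zify [show 1 ≤ 2 * Fintype.card ι by omega] at hi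
          exact_mod_cast hi
        have hk1 : (0 : ℝ) < Fintype.card ι := by exact_mod_cast hk0
        refine le_of_mul_le_mul_left (hi'.trans_eq ?_) (by positivity : 0 < 2 * (Fintype.card ι : ℝ))
        field_simp
      have hc : ((𝓕.image (fun f => Function.update f z i) ∪
          𝓖.image (fun f => Function.update f z j)).card : ℝ) ≤ 𝓕.card + 𝓖.card := by
        exact_mod_cast (Finset.card_union_le _ _).trans
          (Nat.add_le_add Finset.card_image_le Finset.card_image_le)
      have h1' := pow_le_pow_left₀ (Nat.cast_nonneg _) h1 a
      have h2' : ((shatteredSets A (S ∩ A z i) Z).card : ℝ) ^ a ≤ l * (h : ℝ) ^ a := by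
        refine (pow_le_pow_left₀ (Nat.cast_nonneg _) h2 a).trans ?_
        rw [mul_pow]
        gcongr
      rw [Finset.card_insert_of_notMem hz, pow_succ]
      calc _ ≤ (𝓕.card + 𝓖.card : ℝ) := hc
        _ ≤ (h : ℝ) ^ a * (1 + l) ^ Z.card + l * (h : ℝ) ^ a * (1 + l) ^ Z.card := by
          refine add_le_add (hFc.trans ?_) (hGc.trans ?_) <;> gcongr
        _ = _ := by ring

lemma card_le_of_forall_card_lt [Fintype τ] {m : ℕ} {𝓢 : Finset (Finset τ)}
    (h : ∀ W ∈ 𝓢, W.card < m) : 𝓢.card ≤ m * (Fintype.card τ + 1) ^ m := by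
  have hsub : 𝓢 ⊆ (Finset.range m).biUnion fun j => Finset.univ.powersetCard j := fun W hW =>
    Finset.mem_biUnion.2 ⟨W.card, Finset.mem_range.2 (h W hW), by simp [Finset.mem_powersetCard]⟩
  refine (Finset.card_le_card hsub).trans (Finset.card_biUnion_le.trans ?_)
  refine (Finset.sum_le_card_nsmul _ _ ((Fintype.card τ + 1) ^ m) fun j hj => ?_).trans ?_
  · rw [Finset.card_powersetCard, Finset.card_univ]
    refine (Nat.choose_le_pow _ _).trans ((Nat.pow_le_pow_left (Nat.le_succ _) j).trans ?_)
    exact Nat.pow_le_pow_right (Nat.succ_pos _) (Finset.mem_range.1 hj).le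
  · simp

end Combinatorics

section Entropy

variable {G X : Type*} {α : G → X → X}

lemma coverN_le_of_avoiding {κ ι : Type*} {V : ι → Set X} {U : κ → Set X}
    (hUV : ∀ i, ∃ j, U j = V i) {n : ℕ} {g : Fin n → G} {𝓕 : Finset (Fin n → ι)}
    (h : ∀ x, ∃ f ∈ 𝓕, ∀ z, x ∉ α (g z) ⁻¹' V (f z)) :
    coverN (joinPull α (Set.range fun j => (U j)ᶜ) g) ≤ 𝓕.card := by
  set F := 𝓕.image fun f => ⋂ z, α (g z) ⁻¹' (V (f z))ᶜ
  suffices (F : Set (Set X)) ⊆ joinPull α (Set.range fun j => (U j)ᶜ) g ∧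
      ⋃₀ (F : Set (Set X)) = Set.univ by
    have hmem : F.card ∈ {m : ℕ | ∃ F : Finset (Set X),
        ↑F ⊆ joinPull α (Set.range fun j => (U j)ᶜ) g ∧ F.card = m ∧
          ⋃₀ (F : Set (Set X)) = Set.univ} := ⟨F, this.1, rfl, this.2⟩
    exact (Nat.sInf_le hmem).trans Finset.card_image_le
  refine ⟨?_, ?_⟩
  · intro W hW
    obtain ⟨f, -, rfl⟩ := Finset.mem_image.1 (Finset.mem_coe.1 hW)
    refine ⟨fun z => (V (f z))ᶜ, fun z => ?_, rfl⟩
    obtain ⟨j, hj⟩ := hUV (f z)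
    exact ⟨j, by simp [hj]⟩
  · refine Set.eq_univ_of_forall fun x => ?_
    obtain ⟨f, hf, hx⟩ := h x
    exact ⟨_, Finset.mem_coe.2 (Finset.mem_image_of_mem _ hf), by simpa using hx⟩

/-- If the independence sets along a sequence have bounded size, then the sequence entropy
vanishes. -/
lemma seqEntCover_eq_zero_of_bounded {κ ι : Type*} [Fintype ι] [Nontrivial ι] {V : ι → Set X}
    {U : κ → Set X} (hUV : ∀ i, ∃ j, U j = V i) (hV : Pairwise fun i j => Disjoint (V i) (V j))
    (𝔰 : ℕ → G) {m : ℕ}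
    (hm : ∀ (n : ℕ) (W : Finset (Fin n)),
      ShattersOn (fun (z : Fin n) i => α (𝔰 z) ⁻¹' V i) Set.univ W → W.card < m) :
    seqEntCover α 𝔰 (Set.range fun j => (U j)ᶜ) = 0 := by
  refine le_antisymm (le_of_forall_pos_le_add fun ε hε => ?_) bot_le
  rw [zero_add]
  rcases eq_or_ne ε ⊤ with rfl | hεt
  · exact le_top
  set l := ε.toReal
  have hl : 0 < l := ENNReal.toReal_pos hε.ne' hεt
  have hk : (1 : ℝ) ≤ Fintype.card ι := by exact_mod_cast Fintype.card_pos (α := ι)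
  obtain ⟨a, ha⟩ := exists_pow_lt_of_lt_one hl
    (show (1 - 1 / (2 * Fintype.card ι) : ℝ) < 1 by
      have : (0 : ℝ) < 1 / (2 * Fintype.card ι) := by positivity
      linarith)
  have hN : ∀ n : ℕ, Real.log (coverN (joinPull α (Set.range fun j => (U j)ᶜ)
      fun i : Fin n => 𝔰 i)) ≤
      a * Real.log (m + 1) + a * m * Real.log ((n : ℝ) + 1) + n * Real.log (1 + l) := by
    intro n
    set N := coverN (joinPull α (Set.range fun j => (U j)ᶜ) fun i : Fin n => 𝔰 i)
    obtain ⟨𝓕, hF, hFc⟩ := exists_small_avoiding_family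
      (A := fun (z : Fin n) i => α (𝔰 z) ⁻¹' V i)
      (fun z i j hij => (hV hij).preimage _) hl ha.le Finset.univ Set.univ
    have h1 : N ≤ 𝓕.card := coverN_le_of_avoiding hUV fun x => by simpa using hF x trivial
    have h2 := card_le_of_forall_card_lt (m := m)
      (𝓢 := shatteredSets (fun (z : Fin n) i => α (𝔰 z) ⁻¹' V i) Set.univ Finset.univ)
      fun W hW => hm n W (mem_shatteredSets.1 hW).2
    rw [Fintype.card_fin] at h2
    have h3 : (N : ℝ) ≤ (((m : ℝ) + 1) * ((n : ℝ) + 1) ^ m) ^ a * (1 + l) ^ n := by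
      refine (Nat.cast_le.2 h1).trans (hFc.trans ?_)
      rw [Finset.card_univ, Fintype.card_fin]
      gcongr
      refine (Nat.cast_le.2 h2).trans ?_
      push_cast
      gcongr
      linarith
    have h4 : Real.log ((((m : ℝ) + 1) * ((n : ℝ) + 1) ^ m) ^ a * (1 + l) ^ n) =
        a * Real.log (m + 1) + a * m * Real.log ((n : ℝ) + 1) + n * Real.log (1 + l) := by
      rw [Real.log_mul (by positivity) (by positivity), Real.log_pow, Real.log_pow,
        Real.log_mul (by positivity) (by positivity), Real.log_pow]
      ring
    rcases Nat.eq_zero_or_pos N with h0 | h0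
    · rw [h0, Nat.cast_zero, Real.log_zero]
      have := Real.log_nonneg (show (1 : ℝ) ≤ m + 1 by simp)
      have := Real.log_nonneg (show (1 : ℝ) ≤ n + 1 by simp)
      have := Real.log_nonneg (show (1 : ℝ) ≤ 1 + l by linarith)
      positivity
    · rw [← h4]
      exact Real.log_le_log (by exact_mod_cast h0) h3
  have hlim : Tendsto (fun n : ℕ => (a * Real.log (m + 1) + a * m * Real.log ((n : ℝ) + 1) +
      n * Real.log (1 + l)) / n) atTop (𝓝 (Real.log (1 + l))) := by
    have hlog : Tendsto (fun n : ℕ => Real.log ((n : ℝ) + 1) / n) atTop (𝓝 0) := by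
      have h1 : Tendsto (fun x : ℝ => Real.log x / (1 * x + (-1))) atTop (𝓝 0) := by
        simpa using Real.tendsto_pow_log_div_mul_add_atTop 1 (-1) 1 one_ne_zero
      have h2 : Tendsto (fun n : ℕ => (n : ℝ) + 1) atTop atTop :=
        tendsto_atTop_add_const_right _ _ tendsto_natCast_atTop_atTop
      refine (h1.comp h2).congr fun n => ?_
      simp
    have hconst := tendsto_const_div_atTop_nhds_zero_nat (a * Real.log (m + 1))
    have := (hconst.add (hlog.const_mul (a * m : ℝ))).add_const (Real.log (1 + l))
    rw [mul_zero, zero_add, zero_add] at this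
    refine this.congr' ?_
    filter_upwards [eventually_gt_atTop 0] with n hn
    have : (n : ℝ) ≠ 0 := by exact_mod_cast hn.ne'
    field_simp
  calc seqEntCover α 𝔰 (Set.range fun j => (U j)ᶜ)
      ≤ ENNReal.ofReal (Real.log (1 + l)) := by
        rw [← (ENNReal.tendsto_ofReal hlim).limsup_eq]
        refine limsup_le_limsup (Eventually.of_forall fun n => ?_)
        exact ENNReal.ofReal_le_ofReal (div_le_div_of_nonneg_right (hN n) (Nat.cast_nonneg n))
    _ ≤ ENNReal.ofReal l := ENNReal.ofReal_le_ofReal <| by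
        have := Real.log_le_sub_one_of_pos (show 0 < 1 + l by linarith)
        linarith
    _ = ε := ENNReal.ofReal_toReal hεt

lemma pow_card_le_coverN_mul {ι : Type*} [Fintype ι] [Nonempty ι] {U : ι → Set X}
    (hU : ⋂ i, U i = ∅) {n : ℕ} {g : Fin n → G} {W : Finset (Fin n)}
    (hW : ShattersOn (fun z i => α (g z) ⁻¹' U i) Set.univ W) :
    Fintype.card ι ^ W.card ≤
      coverN (joinPull α (Set.range fun i => (U i)ᶜ) g) * (Fintype.card ι - 1) ^ W.card := by
  have hne : {m : ℕ | ∃ F : Finset (Set X), ↑F ⊆ joinPull α (Set.range fun i => (U i)ᶜ) g ∧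
      F.card = m ∧ ⋃₀ (F : Set (Set X)) = Set.univ}.Nonempty := by
    refine ⟨_, Finset.univ.image fun f : Fin n → ι => ⋂ z, α (g z) ⁻¹' (U (f z))ᶜ, ?_, rfl, ?_⟩
    · intro V hV
      obtain ⟨f, -, rfl⟩ := Finset.mem_image.1 (Finset.mem_coe.1 hV)
      exact ⟨fun z => (U (f z))ᶜ, fun z => ⟨f z, rfl⟩, rfl⟩
    · refine Set.eq_univ_of_forall fun x => ?_
      have hex : ∀ y, ∃ i, y ∉ U i := fun y => by
        by_contra! h
        exact (hU ▸ Set.mem_iInter.2 h : y ∈ (∅ : Set X))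
      choose c hc using hex
      exact ⟨_, Finset.mem_coe.2 (Finset.mem_image_of_mem _ (Finset.mem_univ fun z => c (α (g z) x))),
        by simpa using fun z => hc (α (g z) x)⟩
  obtain ⟨F, hFsub, hFcard, hFcov⟩ := Nat.sInf_mem hne
  change F.card = coverN _ at hFcard
  rw [← hFcard]
  have hpt : ∀ ω : W → ι, ∃ V ∈ F, ∃ x ∈ V, ∀ z : W, x ∈ α (g z) ⁻¹' U (ω z) := by
    intro ω
    obtain ⟨x, -, hx⟩ := hW fun z => if hz : z ∈ W then ω ⟨z, hz⟩ else Classical.arbitrary ι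
    obtain ⟨V, hV, hxV⟩ := Set.mem_sUnion.1 (hFcov ▸ Set.mem_univ x)
    refine ⟨V, hV, x, hxV, fun z => ?_⟩
    simpa using hx z z.2
  have hidx : ∀ V ∈ F, ∃ f : Fin n → ι, V = ⋂ z, α (g z) ⁻¹' (U (f z))ᶜ := by
    intro V hV
    obtain ⟨u, hu, rfl⟩ := hFsub hV
    choose f hf using hu
    exact ⟨f, by simp only [← hf]⟩
  choose! f hf using hidx
  have hsub : (Finset.univ : Finset (W → ι)) ⊆
      F.biUnion fun V => Fintype.piFinset fun z : W => {f V z}ᶜ := by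
    intro ω _
    obtain ⟨V, hV, x, hxV, hx⟩ := hpt ω
    refine Finset.mem_biUnion.2 ⟨V, hV, Fintype.mem_piFinset.2 fun z => ?_⟩
    rw [Finset.mem_compl, Finset.mem_singleton]
    intro h
    rw [hf V hV] at hxV
    have h1 := Set.mem_iInter.1 hxV z
    rw [← h] at h1
    exact h1 (hx z)
  have := (Finset.card_le_card hsub).trans Finset.card_biUnion_le
  simpa [Fintype.card_piFinset, Finset.card_compl] using this

/-- Arbitrarily large finite independence sets produce a sequence of positive entropy. -/
lemma exists_seqEntCover_pos [One G] {k : ℕ} (hk : 2 ≤ k) {U : Fin k → Set X}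
    (hU : ⋂ i, U i = ∅) (h : HasArbLargeIndep α U) :
    ∃ 𝔰 : ℕ → G, 0 < seqEntCover α 𝔰 (Set.range fun i => (U i)ᶜ) := by
  choose F hFc hF using fun m : ℕ => h (2 ^ m)
  have hemb : ∀ m, ∃ e : Fin (2 ^ m) ↪ G, Set.range e ⊆ F m := fun m =>
    Function.Embedding.exists_of_card_le_finset (by simpa using hFc m)
  choose e he using hemb
  set E : ℕ → ℕ → G := fun m i => if hi : i < 2 ^ m then e m ⟨i, hi⟩ else 1 with hE
  set 𝔰 : ℕ → G := fun i => E (Nat.log 2 (i + 1)) (i + 1 - 2 ^ Nat.log 2 (i + 1)) with hs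
  have hsE : ∀ m i, i < 2 ^ m → 𝔰 (2 ^ m - 1 + i) = E m i := by
    intro m i hi
    have hpos := Nat.two_pow_pos m
    have h1 : 2 ^ m - 1 + i + 1 = 2 ^ m + i := by omega
    have h2 : Nat.log 2 (2 ^ m + i) = m :=
      (Nat.log_eq_iff (Or.inr ⟨one_lt_two, by omega⟩)).2 ⟨by omega, by rw [pow_succ]; omega⟩
    simp only [hs, h1, h2, Nat.add_sub_cancel_left]
  refine ⟨𝔰, ?_⟩
  have hk1 : (0 : ℝ) < (k : ℝ) - 1 := by
    have : (2 : ℝ) ≤ k := by exact_mod_cast hk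
    linarith
  set c := Real.log (k / (k - 1))
  have hc : 0 < c := Real.log_pos (by rw [one_lt_div hk1]; linarith)
  have hN : ∀ m : ℕ, 2 ^ m * c ≤ Real.log (coverN (joinPull α (Set.range fun i => (U i)ᶜ)
      fun i : Fin (2 ^ (m + 1) - 1) => 𝔰 i)) := by
    intro m
    set N := coverN (joinPull α (Set.range fun i => (U i)ᶜ) fun i : Fin (2 ^ (m + 1) - 1) => 𝔰 i)
    have hpos := Nat.two_pow_pos m
    have hlt : ∀ i : Fin (2 ^ m), 2 ^ m - 1 + (i : ℕ) < 2 ^ (m + 1) - 1 := fun i => by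
      have := i.2
      rw [pow_succ]; omega
    let φ : Fin (2 ^ m) ↪ Fin (2 ^ (m + 1) - 1) :=
      ⟨fun i => ⟨2 ^ m - 1 + i, hlt i⟩, fun i j hij => by
        have := congrArg Fin.val hij
        simp only at this
        exact Fin.ext (by omega)⟩
    have hφ : ∀ i, 𝔰 (φ i) = e m i := fun i => by
      change 𝔰 (2 ^ m - 1 + i) = _
      rw [hsE m i i.2]
      simp [hE]
    have hsh : ShattersOn (fun (z : Fin (2 ^ (m + 1) - 1)) i => α (𝔰 z) ⁻¹' U i) Set.univ
        (Finset.univ.map φ) := by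
      intro ω
      have hω : ∃ ω' : G → Fin k, ∀ i, ω' (e m i) = ω (φ i) :=
        ⟨Function.extend (e m) (ω ∘ φ) fun _ => ⟨0, by omega⟩, fun i =>
          (e m).injective.extend_apply _ _ _⟩
      obtain ⟨ω', hω'⟩ := hω
      obtain ⟨x, hx⟩ := hF m (Finset.univ.map (e m))
        (fun g hg => by
          obtain ⟨i, -, rfl⟩ := Finset.mem_map.1 (Finset.mem_coe.1 hg)
          exact he m ⟨i, rfl⟩)
        ⟨e m ⟨0, hpos⟩, Finset.mem_map_of_mem _ (Finset.mem_univ _)⟩ ω'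
      refine ⟨x, trivial, fun z hz => ?_⟩
      obtain ⟨i, -, rfl⟩ := Finset.mem_map.1 hz
      change x ∈ α (𝔰 (φ i)) ⁻¹' U (ω (φ i))
      rw [hφ, ← hω']
      exact Set.mem_iInter₂.1 hx (e m i) (Finset.mem_map_of_mem _ (Finset.mem_univ _))
    have : Nonempty (Fin k) := ⟨⟨0, by omega⟩⟩
    have h1 := pow_card_le_coverN_mul hU hsh
    rw [Finset.card_map, Finset.card_univ, Fintype.card_fin, Fintype.card_fin] at h1
    have h2 : ((k : ℝ) / (k - 1)) ^ 2 ^ m ≤ N := by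
      rw [div_pow, div_le_iff₀ (by positivity)]
      have h3 := (Nat.cast_le (α := ℝ)).2 h1
      push_cast [Nat.cast_sub (show 1 ≤ k by omega)] at h3
      exact h3
    have h3 := Real.log_le_log (by positivity) h2
    rw [Real.log_pow] at h3
    push_cast at h3
    exact h3
  have hfreq : ∃ᶠ n in atTop, ENNReal.ofReal (c / 2) ≤
      ENNReal.ofReal (Real.log (coverN (joinPull α (Set.range fun i => (U i)ᶜ)
        fun i : Fin n => 𝔰 i)) / n) := by
    rw [frequently_atTop]
    intro M
    have hM : M < 2 ^ M := Nat.lt_two_pow_self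
    refine ⟨2 ^ (M + 1) - 1, by rw [pow_succ]; omega, ENNReal.ofReal_le_ofReal ?_⟩
    have hpos : 0 < 2 ^ (M + 1) - 1 := by rw [pow_succ]; omega
    rw [le_div_iff₀ (by exact_mod_cast hpos)]
    refine le_trans ?_ (hN M)
    have h1 : ((2 ^ (M + 1) - 1 : ℕ) : ℝ) ≤ 2 * 2 ^ M := by
      have : 2 ^ (M + 1) - 1 ≤ 2 * 2 ^ M := by rw [pow_succ]; omega
      exact_mod_cast this
    nlinarith
  exact (ENNReal.ofReal_pos.2 (half_pos hc)).trans_le (le_limsup_of_frequently_le hfreq)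

end Entropy

/-- Kerr–Li: a non-diagonal tuple is a sequence entropy tuple iff it is an
IN-tuple. -/
theorem seqEntropyTuple_iff_INTuple
    {G X : Type*} [Group G] [Countable G] [Infinite G] [MetricSpace X] [CompactSpace X]
    (α : G → X → X) (hα : IsActionBy α) {k : ℕ} (hk : 2 ≤ k)
    (x : Fin k → X) (hx : ∃ i j, x i ≠ x j) :
    IsSeqEntropyTuple α x ↔ IsINTuple α x := by
  constructor
  · rintro ⟨-, h⟩ U hUo hxU
    obtain ⟨O, hO, hOd⟩ := (Set.finite_range x).t2_separation
    have hV : ∀ p, ∃ V ∈ 𝓝 p, IsClosed V ∧ V ⊆ O p ∩ ⋂ i, ⋂ _ : x i = p, U i := by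
      refine fun p => exists_mem_nhds_isClosed_subset (inter_mem ((hO p).2.mem_nhds (hO p).1) ?_)
      refine Filter.iInter_mem.2 fun i => Filter.iInter_mem.2 ?_
      rintro rfl
      exact (hUo i).mem_nhds (hxU i)
    choose V hVn hVc hVs using hV
    have hVd : Pairwise fun p q : Set.range x => Disjoint (V p) (V q) := fun p q hpq =>
      (hOd p.2 q.2 (Subtype.coe_injective.ne hpq)).mono
        ((hVs p).trans inter_subset_left) ((hVs q).trans inter_subset_left)
    have hVU : ∀ i, V (x i) ⊆ U i := fun i y hy =>
      Set.mem_iInter₂.1 (hVs (x i) hy).2 i rfl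
    obtain ⟨𝔰, hs⟩ := h (fun i => V (x i)) (fun i => hVc _) (fun i => hVn _)
      (fun i j hij => by rw [hij])
      (fun i j hij => hVd (i := ⟨x i, i, rfl⟩) (j := ⟨x j, j, rfl⟩) (fun h => hij (congrArg Subtype.val h)))
    have : Fintype (Set.range x) := Fintype.ofFinite _
    obtain ⟨i₀, j₀, hij⟩ := hx
    have hne : (⟨x i₀, i₀, rfl⟩ : Set.range x) ≠ ⟨x j₀, j₀, rfl⟩ := fun h => hij (congrArg Subtype.val h)
    have : Nontrivial (Set.range x) := ⟨_, _, hne⟩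
    by_contra hcon
    unfold HasArbLargeIndep at hcon
    push Not at hcon
    obtain ⟨m, hm⟩ := hcon
    refine hs.ne' (seqEntCover_eq_zero_of_bounded (V := fun p : Set.range x => V p) (m := m)
      ?_ hVd 𝔰 fun n W hW => ?_)
    · rintro ⟨_, i, rfl⟩
      exact ⟨i, rfl⟩
    · by_contra! hmW
      have hinj : Set.InjOn (fun z : Fin n => 𝔰 z) W := by
        intro z hz z' hz' hzz
        by_contra hzne
        obtain ⟨y, -, hy⟩ := hW fun t => if t = z then ⟨x i₀, i₀, rfl⟩ else ⟨x j₀, j₀, rfl⟩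
        have h1 : α (𝔰 z) y ∈ V (x i₀) := by simpa using hy z hz
        have h2 : α (𝔰 z') y ∈ V (x j₀) := by simpa [Ne.symm hzne] using hy z' hz'
        rw [← show 𝔰 z = 𝔰 z' from hzz] at h2
        exact Set.disjoint_left.1 (hVd hne) h1 h2
      refine hm (W.image fun z : Fin n => 𝔰 z) (by rwa [Finset.card_image_of_injOn hinj]) ?_
      intro F hF _ ω
      obtain ⟨y, -, hy⟩ := hW fun z : Fin n => ⟨x (ω (𝔰 z)), _, rfl⟩
      refine ⟨y, Set.mem_iInter₂.2 fun g hg => ?_⟩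
      obtain ⟨z, hz, rfl⟩ := Finset.mem_image.1 (Finset.mem_coe.1 (hF hg))
      exact hVU _ (hy z hz)
  · refine fun h => ⟨hx, fun U _ hUn _ hUd => exists_seqEntCover_pos hk ?_ fun n => ?_⟩
    · obtain ⟨i, j, hij⟩ := hx
      refine Set.eq_empty_of_forall_notMem fun y hy => ?_
      exact Set.disjoint_left.1 (hUd i j hij) (Set.mem_iInter.1 hy i) (Set.mem_iInter.1 hy j)
    · obtain ⟨F, hFn, hF⟩ := h (fun i => interior (U i)) (fun i => isOpen_interior)
        (fun i => mem_interior_iff_mem_nhds.2 (hUn i)) n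
      refine ⟨F, hFn, fun F' hF' hne ω => (hF F' hF' hne ω).mono ?_⟩
      exact Set.iInter₂_mono fun g _ => Set.preimage_mono interior_subset
end

section
/- Let (X,G,α) be a topological dynamical system. Then the maximal pattern entropy satisfies h*_{top}(X,G) = log(sup{k ∈ ℕ : IN_k^e(X,G) ≠ ∅}); in particular h*_{top}(X,G) equals +∞ or log(k) for some k ∈ ℕ. -/
open Filter Topology Set
open scoped ENNReal Classical

section Combinatorics

variable {β : Type*}

/-- Some `d` coordinates `J` and sets `A j ∈ 𝒜` for `j ∈ J` are such that the restriction of `S`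
to `J` contains the box `∏ A j`. -/
def Shatters {n : ℕ} (𝒜 : Finset (Finset β)) (S : Finset (Fin n → β)) (d : ℕ) : Prop :=
  ∃ J : Finset (Fin n), J.card = d ∧ ∃ A : Fin n → Finset β, (∀ j ∈ J, A j ∈ 𝒜) ∧
    ∀ ω : Fin n → β, (∀ j ∈ J, ω j ∈ A j) → ∃ s ∈ S, ∀ j ∈ J, s j = ω j

theorem Shatters.of_tail [Fintype β] {n d : ℕ} {𝒜 : Finset (Finset β)}
    {S : Finset (Fin (n + 1) → β)} (h : Shatters 𝒜 (S.image Fin.tail) d) : Shatters 𝒜 S d := by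
  obtain ⟨J, hJ, A, hA, h⟩ := h
  refine ⟨J.map (Fin.succEmb n), by simpa using hJ, Fin.cons ∅ A, ?_, ?_⟩
  · intro j hj
    obtain ⟨i, hi, rfl⟩ := Finset.mem_map.1 hj
    simpa using hA i hi
  · intro ω hω
    obtain ⟨t, ht, hts⟩ := h (Fin.tail ω) fun j hj => by
      simpa [Fin.tail] using hω j.succ (Finset.mem_map.2 ⟨j, hj, rfl⟩)
    obtain ⟨s, hs, rfl⟩ := Finset.mem_image.1 ht
    refine ⟨s, hs, fun j hj => ?_⟩
    obtain ⟨i, hi, rfl⟩ := Finset.mem_map.1 hj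
    exact hts i hi

theorem Shatters.of_fiber [Fintype β] {n d : ℕ} {𝒜 : Finset (Finset β)}
    {S : Finset (Fin (n + 1) → β)} {B : Finset β} (hB : B ∈ 𝒜)
    (h : Shatters 𝒜 (Finset.univ.filter fun t : Fin n → β => ∀ b ∈ B, Fin.cons b t ∈ S) d) :
    Shatters 𝒜 S (d + 1) := by
  obtain ⟨J, hJ, A, hA, h⟩ := h
  refine ⟨insert 0 (J.map (Fin.succEmb n)), ?_, Fin.cons B A, ?_, ?_⟩
  · rw [Finset.card_insert_of_notMem, Finset.card_map, hJ]
    simp [Fin.succ_ne_zero]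
  · intro j hj
    rcases Finset.mem_insert.1 hj with rfl | hj
    · simpa using hB
    obtain ⟨i, hi, rfl⟩ := Finset.mem_map.1 hj
    simpa using hA i hi
  · intro ω hω
    obtain ⟨t, ht, hts⟩ := h (Fin.tail ω) fun j hj => by
      simpa [Fin.tail] using
        hω j.succ (Finset.mem_insert_of_mem (Finset.mem_map.2 ⟨j, hj, rfl⟩))
    refine ⟨Fin.cons (ω 0) t, (Finset.mem_filter.1 ht).2 _ ?_, fun j hj => ?_⟩
    · simpa using hω 0 (Finset.mem_insert_self _ _)
    rcases Finset.mem_insert.1 hj with rfl | hj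
    · simp
    obtain ⟨i, hi, rfl⟩ := Finset.mem_map.1 hj
    simpa [Fin.tail] using hts i hi

/-- A weighted Sauer–Shelah–Natarajan bound. -/
theorem shatters_or_sum_prod_le [Fintype β] (𝒜 : Finset (Finset β)) (w : β → ℝ)
    (hw : ∀ b, 0 ≤ w b) {κ M : ℝ} (hκ : 1 ≤ κ)
    (hF : ∀ F : Finset β, (∀ A ∈ 𝒜, ¬ A ⊆ F) → ∑ b ∈ F, w b ≤ κ)
    (hM : 𝒜.card * ∑ b, w b ≤ M) (n : ℕ) :
    ∀ (d : ℕ) (S : Finset (Fin n → β)),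
      Shatters 𝒜 S d ∨ ∑ s ∈ S, ∏ i, w (s i) ≤ κ ^ n * (1 + M * n) ^ d := by
  have hw0 : 0 ≤ ∑ b, w b := Finset.sum_nonneg fun b _ => hw b
  have hM0 : 0 ≤ M := le_trans (by positivity) hM
  induction n with
  | zero =>
    intro d S
    right
    have : ∑ s ∈ S, ∏ i, w (s i) ≤ ∑ s : Fin 0 → β, ∏ i, w (s i) :=
      Finset.sum_le_sum_of_subset_of_nonneg (Finset.subset_univ _) (by simp)
    simpa using this
  | succ n ih =>
    intro d S
    rcases d with _ | d
    · rcases S.eq_empty_or_nonempty with rfl | ⟨s, hs⟩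
      · right; simp; positivity
      · left
        exact ⟨∅, rfl, fun _ => ∅, by simp, fun ω _ => ⟨s, hs, by simp⟩⟩
    by_cases hS : Shatters 𝒜 S (d + 1)
    · exact Or.inl hS
    right
    set T := S.image Fin.tail with hT
    set R : Finset β → Finset (Fin n → β) := fun B =>
      Finset.univ.filter fun t : Fin n → β => ∀ b ∈ B, Fin.cons b t ∈ S with hR
    have h1 := (ih (d + 1) T).resolve_left fun h => hS h.of_tail
    have h2 : ∀ B ∈ 𝒜, ∑ t ∈ R B, ∏ i, w (t i) ≤ κ ^ n * (1 + M * n) ^ d := fun B hB =>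
      (ih d (R B)).resolve_left fun h => hS (h.of_fiber hB)
    have hp : ∀ t : Fin n → β, 0 ≤ ∏ i, w (t i) := fun t => Finset.prod_nonneg fun i _ => hw _
    have h3 : ∑ s ∈ S, ∏ i, w (s i) =
        ∑ t ∈ T, ∑ b ∈ Finset.univ.filter (fun b => (Fin.cons b t : Fin (n + 1) → β) ∈ S),
          w b * ∏ i, w (t i) := by
      rw [Finset.sum_sigma']
      refine Finset.sum_bij' (fun s _ => ⟨Fin.tail s, s 0⟩) (fun p _ => Fin.cons p.2 p.1)
        ?_ ?_ ?_ ?_ ?_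
      · intro s hs
        simp only [Finset.mem_sigma, Finset.mem_filter, Finset.mem_univ, true_and,
          Fin.cons_self_tail]
        exact ⟨Finset.mem_image_of_mem _ hs, hs⟩
      · intro p hp
        simp only [Finset.mem_sigma, Finset.mem_filter, Finset.mem_univ, true_and] at hp
        exact hp.2
      · intro s _; simp
      · intro p _; simp
      · intro s _
        rw [Fin.prod_univ_succ]; rfl
    have h4 : ∀ t ∈ T,
        ∑ b ∈ Finset.univ.filter (fun b => (Fin.cons b t : Fin (n + 1) → β) ∈ S),
          w b * ∏ i, w (t i) ≤ κ * ∏ i, w (t i) +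
            ∑ B ∈ 𝒜, if t ∈ R B then (∑ b, w b) * ∏ i, w (t i) else 0 := by
      intro t _
      rw [← Finset.sum_mul]
      have hnn : ∀ B ∈ 𝒜, 0 ≤ if t ∈ R B then (∑ b, w b) * ∏ i, w (t i) else 0 := by
        intro B _
        have := hp t
        split_ifs <;> positivity
      by_cases hB : ∃ B ∈ 𝒜, t ∈ R B
      · obtain ⟨B, hB, htB⟩ := hB
        have h5 := Finset.single_le_sum hnn hB
        rw [if_pos htB] at h5
        have h6 : (∑ b ∈ Finset.univ.filter
            (fun b => (Fin.cons b t : Fin (n + 1) → β) ∈ S), w b) ≤ ∑ b, w b :=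
          Finset.sum_le_sum_of_subset_of_nonneg (Finset.subset_univ _) fun b _ _ => hw b
        have h7 := mul_le_mul_of_nonneg_right h6 (hp t)
        have h8 : 0 ≤ κ * ∏ i, w (t i) := mul_nonneg (by linarith) (hp t)
        linarith
      · have h5 := Finset.sum_nonneg hnn
        have h6 := hF (Finset.univ.filter
            (fun b => (Fin.cons b t : Fin (n + 1) → β) ∈ S)) (by
          intro A hA hsub
          refine hB ⟨A, hA, ?_⟩
          simp only [hR, Finset.mem_filter, Finset.mem_univ, true_and]
          intro b hb
          simpa using hsub hb)
        have h7 := mul_le_mul_of_nonneg_right h6 (hp t)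
        linarith
    have h5 : ∑ t ∈ T, ∑ B ∈ 𝒜, (if t ∈ R B then (∑ b, w b) * ∏ i, w (t i) else 0) ≤
        M * (κ ^ n * (1 + M * n) ^ d) := by
      rw [Finset.sum_comm]
      calc _ ≤ ∑ B ∈ 𝒜, (∑ b, w b) * (κ ^ n * (1 + M * n) ^ d) := by
            refine Finset.sum_le_sum fun B hB => ?_
            rw [← Finset.sum_filter, ← Finset.mul_sum]
            refine mul_le_mul_of_nonneg_left (le_trans ?_ (h2 B hB)) hw0
            exact Finset.sum_le_sum_of_subset_of_nonneg
              (fun t ht => (Finset.mem_filter.1 ht).2) fun t _ _ => hp t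
        _ = (𝒜.card * ∑ b, w b) * (κ ^ n * (1 + M * n) ^ d) := by
            rw [Finset.sum_const, nsmul_eq_mul]; ring
        _ ≤ _ := mul_le_mul_of_nonneg_right hM (by positivity)
    have hx : (0 : ℝ) ≤ 1 + M * n := by positivity
    calc ∑ s ∈ S, ∏ i, w (s i) ≤ κ * ∑ t ∈ T, ∏ i, w (t i) +
          ∑ t ∈ T, ∑ B ∈ 𝒜, (if t ∈ R B then (∑ b, w b) * ∏ i, w (t i) else 0) := by
          rw [h3, Finset.mul_sum, ← Finset.sum_add_distrib]
          exact Finset.sum_le_sum h4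
      _ ≤ κ * (κ ^ n * (1 + M * n) ^ (d + 1)) + M * (κ ^ n * (1 + M * n) ^ d) := by
          gcongr
      _ ≤ κ * (κ ^ n * (1 + M * n) ^ (d + 1)) + κ * (M * (κ ^ n * (1 + M * n) ^ d)) := by
          refine add_le_add le_rfl (le_mul_of_one_le_left ?_ hκ)
          positivity
      _ = κ ^ (n + 1) * ((1 + M * n) ^ d * (1 + M * (n + 1 : ℕ))) := by
          push_cast; ring
      _ ≤ κ ^ (n + 1) * ((1 + M * (n + 1 : ℕ)) ^ d * (1 + M * (n + 1 : ℕ))) := by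
          gcongr
          simp
      _ = _ := by ring

theorem eventually_mul_pow_mul_pow_lt {c κ v M : ℝ} (hκ : 0 < κ) (hv : κ < v) (hM : 0 ≤ M)
    (d : ℕ) : ∀ᶠ n : ℕ in atTop, c * (κ ^ n * (1 + M * n) ^ d) < v ^ n := by
  have hv0 : 0 < v := hκ.trans hv
  have hr : |κ / v| < 1 := by
    rw [abs_of_pos (by positivity), div_lt_one hv0]; exact hv
  have h1 := tendsto_pow_const_mul_const_pow_of_abs_lt_one d hr
  have h2 : Tendsto (fun n : ℕ => (|c| * (1 + M) ^ d) * ((n : ℝ) ^ d * (κ / v) ^ n)) atTop (𝓝 0) := by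
    simpa using h1.const_mul (|c| * (1 + M) ^ d)
  filter_upwards [h2.eventually (gt_mem_nhds one_pos), eventually_ge_atTop 1] with n hn hn1
  have hn1' : (1 : ℝ) ≤ n := by exact_mod_cast hn1
  have h3 : (1 + M * n) ^ d ≤ (1 + M) ^ d * (n : ℝ) ^ d := by
    rw [← mul_pow]
    refine pow_le_pow_left₀ (by positivity) (by nlinarith) d
  rw [div_pow] at hn
  have h4 : |c| * (κ ^ n * ((1 + M) ^ d * (n : ℝ) ^ d)) < v ^ n := by
    have h5 := mul_lt_mul_of_pos_right hn (pow_pos hv0 n)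
    have h6 : |c| * (1 + M) ^ d * ((n : ℝ) ^ d * (κ ^ n / v ^ n)) * v ^ n =
        |c| * (κ ^ n * ((1 + M) ^ d * (n : ℝ) ^ d)) := by
      field_simp
    linarith
  refine lt_of_le_of_lt ?_ h4
  have : 0 ≤ κ ^ n * (1 + M * n) ^ d := by positivity
  calc c * (κ ^ n * (1 + M * n) ^ d) ≤ |c| * (κ ^ n * (1 + M * n) ^ d) := by
        gcongr; exact le_abs_self c
    _ ≤ _ := by gcongr

end Combinatorics

section Independence

variable {G X β : Type*}

/-- The family `P` restricted to indices in `A` has arbitrarily large finite independence sets. -/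
def ArbIndepOn (α : G → X → X) (P : β → Set X) (A : Set β) : Prop :=
  ∀ d : ℕ, ∃ F : Finset G, d ≤ F.card ∧
    ∀ ω : G → β, (∀ g, ω g ∈ A) → ∃ x, ∀ g ∈ F, α g x ∈ P (ω g)

theorem ArbIndepOn.hasArbLargeIndep {α : G → X → X} {P : β → Set X} {A : Set β}
    (h : ArbIndepOn α P A) {k : ℕ} (e : Fin k → β) (he : ∀ i, e i ∈ A) :
    HasArbLargeIndep α (fun i => P (e i)) := by
  intro n
  obtain ⟨F, hF, h⟩ := h n
  refine ⟨F, hF, fun F' hF' _ ω => ?_⟩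
  obtain ⟨x, hx⟩ := h (fun g => e (ω g)) fun g => he _
  exact ⟨x, Set.mem_iInter₂.2 fun g hg => hx g (hF' hg)⟩

theorem HasArbLargeIndep.mono {α : G → X → X} {k : ℕ} {A B : Fin k → Set X}
    (h : HasArbLargeIndep α A) (hAB : ∀ i, A i ⊆ B i) : HasArbLargeIndep α B := by
  intro n
  obtain ⟨F, hF, h⟩ := h n
  refine ⟨F, hF, fun F' hF' hne ω => (h F' hF' hne ω).mono ?_⟩
  exact Set.iInter₂_mono fun g _ => Set.preimage_mono (hAB _)

theorem HasArbLargeIndep.nonempty {α : G → X → X} {k : ℕ} {A : Fin k → Set X}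
    (h : HasArbLargeIndep α A) (i : Fin k) : (A i).Nonempty := by
  obtain ⟨F, hF, h⟩ := h 1
  have hne : F.Nonempty := Finset.card_pos.1 hF
  obtain ⟨x, hx⟩ := h F subset_rfl hne fun _ => i
  obtain ⟨g, hg⟩ := hne
  exact ⟨α g x, Set.mem_iInter₂.1 hx g hg⟩

/-- Exactly `n` independent elements, listed without repetition. -/
theorem HasArbLargeIndep.exists_fin {α : G → X → X} {k : ℕ} {A : Fin k → Set X}
    (h : HasArbLargeIndep α A) {n : ℕ} (hn : n ≠ 0) :
    ∃ g : Fin n → G, ∀ ω : Fin n → Fin k, ∃ x, ∀ i, α (g i) x ∈ A (ω i) := by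
  obtain ⟨F, hF, h⟩ := h n
  obtain ⟨F', hF', hcard⟩ := Finset.exists_subset_card_eq hF
  let e := F'.equivFinOfCardEq hcard
  refine ⟨fun i => (e.symm i : G), fun ω => ?_⟩
  have : F'.Nonempty := Finset.card_pos.1 (by omega)
  obtain ⟨g₀, hg₀⟩ := this
  obtain ⟨x, hx⟩ := h F' (by exact_mod_cast hF') ⟨g₀, hg₀⟩
    fun g => if hg : g ∈ F' then ω (e ⟨g, hg⟩) else ω (e ⟨g₀, hg₀⟩)
  refine ⟨x, fun i => ?_⟩
  have h1 := Set.mem_iInter₂.1 hx (e.symm i) (e.symm i).2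
  simpa using h1

theorem exists_shattered_of_not_arbIndepOn [Fintype β] (α : G → X → X) (P : β → Set X)
    (𝒜 : Finset (Finset β)) (h𝒜 : ∀ A ∈ 𝒜, ∃ a ∈ A, ∃ b ∈ A, Disjoint (P a) (P b))
    (hno : ∀ A ∈ 𝒜, ¬ ArbIndepOn α P (A : Set β)) :
    ∃ d : ℕ, ∀ (n : ℕ) (g : Fin n → G) (S : Finset (Fin n → β)),
      (∀ s ∈ S, ∃ x, ∀ i, α (g i) x ∈ P (s i)) → ¬ Shatters 𝒜 S d := by
  have : ∀ A : Finset β, ∃ d : ℕ, A ∈ 𝒜 → ¬ ∃ F : Finset G, d ≤ F.card ∧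
      ∀ ω : G → β, (∀ g, ω g ∈ (A : Set β)) → ∃ x, ∀ g ∈ F, α g x ∈ P (ω g) := by
    intro A
    by_cases hA : A ∈ 𝒜
    · have := hno A hA
      unfold ArbIndepOn at this
      push Not at this
      obtain ⟨d, hd⟩ := this
      refine ⟨d, fun _ => ?_⟩
      push Not
      exact hd
    · exact ⟨0, fun h => absurd h hA⟩
  choose d hd using this
  set D := ∑ A ∈ 𝒜, d A + 1 with hD
  refine ⟨𝒜.card * D + 1, fun n g S hS => ?_⟩
  rintro ⟨J, hJ, A, hA, hsh⟩
  rcases 𝒜.eq_empty_or_nonempty with h0 | h0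
  · obtain ⟨j, hj⟩ := Finset.card_pos.1 (hJ ▸ Nat.succ_pos _ : 0 < J.card)
    exact absurd (hA j hj) (h0 ▸ Finset.notMem_empty _)
  obtain ⟨A₀, hA₀, hc⟩ := Finset.exists_le_card_fiber_of_mul_le_card_of_maps_to hA h0
    (show 𝒜.card * D ≤ J.card by omega)
  set J' := J.filter fun j => A j = A₀ with hJ'
  have hext : ∀ ω : Fin n → β, (∀ j ∈ J', ω j ∈ A₀) →
      ∃ x, ∀ j ∈ J', α (g j) x ∈ P (ω j) := by
    intro ω hω
    have hne : ∀ j ∈ J, ∃ b, b ∈ A j := fun j hj => by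
      obtain ⟨a, ha, _⟩ := h𝒜 _ (hA j hj)
      exact ⟨a, ha⟩
    obtain ⟨s, hs, hsω⟩ := hsh
      (fun j => if hj : j ∈ J ∧ j ∉ J' then (hne j hj.1).choose else ω j) (by
        intro j hj
        by_cases hj' : j ∈ J'
        · simp only [hj', not_true_eq_false, and_false, dite_false]
          rw [(Finset.mem_filter.1 hj').2]
          exact hω j hj'
        · rw [dif_pos ⟨hj, hj'⟩]
          exact (hne j hj).choose_spec)
    obtain ⟨x, hx⟩ := hS s hs
    refine ⟨x, fun j hj => ?_⟩
    have := hsω j (Finset.mem_filter.1 hj).1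
    simp only [hj, not_true_eq_false, and_false, dite_false] at this
    exact this ▸ hx j
  have hinj : Set.InjOn g J' := by
    intro i hi j hj hij
    by_contra hne
    obtain ⟨a, ha, b, hb, hab⟩ := h𝒜 A₀ hA₀
    obtain ⟨x, hx⟩ := hext (fun l => if l = i then a else b) (by
      intro l _
      split_ifs <;> assumption)
    have h1 := hx i hi
    have h2 := hx j hj
    rw [if_pos rfl] at h1
    rw [if_neg (Ne.symm hne), ← hij] at h2
    exact Set.disjoint_left.1 hab h1 h2
  refine hd A₀ hA₀ ⟨J'.image g, ?_, fun ω hω => ?_⟩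
  · rw [Finset.card_image_of_injOn hinj]
    have := Finset.single_le_sum (fun A _ => Nat.zero_le (d A)) hA₀
    omega
  · obtain ⟨x, hx⟩ := hext (fun j => ω (g j)) fun j _ => hω _
    refine ⟨x, fun y hy => ?_⟩
    obtain ⟨j, hj, rfl⟩ := Finset.mem_image.1 hy
    exact hx j hj

/-- If no member of `𝒜` is arbitrarily largely independent, the weighted number of realized
patterns grows at rate at most `κ`. -/
theorem exists_sum_prod_le_of_not_arbIndepOn [Fintype β] (α : G → X → X) (P : β → Set X)
    (𝒜 : Finset (Finset β)) (h𝒜 : ∀ A ∈ 𝒜, ∃ a ∈ A, ∃ b ∈ A, Disjoint (P a) (P b))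
    (hno : ∀ A ∈ 𝒜, ¬ ArbIndepOn α P (A : Set β))
    (w : β → ℝ) (hw : ∀ b, 0 ≤ w b) {κ M : ℝ} (hκ : 1 ≤ κ)
    (hF : ∀ F : Finset β, (∀ A ∈ 𝒜, ¬ A ⊆ F) → ∑ b ∈ F, w b ≤ κ)
    (hM : 𝒜.card * ∑ b, w b ≤ M) :
    ∃ d : ℕ, ∀ (n : ℕ) (g : Fin n → G) (S : Finset (Fin n → β)),
      (∀ s ∈ S, ∃ x, ∀ i, α (g i) x ∈ P (s i)) →
        ∑ s ∈ S, ∏ i, w (s i) ≤ κ ^ n * (1 + M * n) ^ d := by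
  obtain ⟨d, hd⟩ := exists_shattered_of_not_arbIndepOn α P 𝒜 h𝒜 hno
  exact ⟨d, fun n g S hS =>
    (shatters_or_sum_prod_le 𝒜 w hw hκ hF hM n d S).resolve_left (hd n g S hS)⟩

end Independence

section Splitting

variable {G X : Type*}

theorem HasArbLargeIndep.exists_update {α : G → X → X} {k : ℕ} (hk : 1 ≤ k)
    {A : Fin (k + 1) → Set X} (hA : Pairwise fun i j => Disjoint (A i) (A j))
    (h : HasArbLargeIndep α A) {γ : Type*} [Fintype γ] (C : γ → Set X)
    (hC : ∀ x, ∃ c, x ∈ C c) (i₀ : Fin (k + 1)) :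
    ∃ c, HasArbLargeIndep α (Function.update A i₀ (A i₀ ∩ C c)) := by
  by_contra hcon
  push Not at hcon
  have hγ : Nonempty γ := by
    obtain ⟨x, _⟩ := h.nonempty i₀
    obtain ⟨c, _⟩ := hC x
    exact ⟨c⟩
  set q : ℝ := (Fintype.card γ : ℝ) with hq
  have hq0 : 0 < q := by
    rw [hq]; exact_mod_cast Fintype.card_pos
  let P : Fin (k + 1) ⊕ γ → Set X := Sum.elim A fun c => A i₀ ∩ C c
  let e : γ → Fin (k + 1) → Fin (k + 1) ⊕ γ := fun c => Function.update Sum.inl i₀ (Sum.inr c)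
  have hPe : ∀ c, (fun i => P (e c i)) = Function.update A i₀ (A i₀ ∩ C c) := by
    intro c
    funext i
    by_cases hi : i = i₀
    · subst hi; simp [P, e]
    · simp [P, e, Function.update_of_ne hi]
  let 𝒜 : Finset (Finset (Fin (k + 1) ⊕ γ)) :=
    Finset.univ.image fun c => Finset.univ.image (e c)
  let w : Fin (k + 1) ⊕ γ → ℝ := Sum.elim (fun i => if i = i₀ then 0 else 1) fun _ => q⁻¹
  have hw : ∀ b, 0 ≤ w b := by
    rintro (i | c)
    · simp only [w, Sum.elim_inl]; split_ifs <;> norm_num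
    · simp only [w, Sum.elim_inr]; positivity
  have hwl : ∑ i : Fin (k + 1), w (Sum.inl i) = k := by
    simp only [w, Sum.elim_inl]
    rw [← Finset.add_sum_erase _ _ (Finset.mem_univ i₀), if_pos rfl,
      Finset.sum_congr rfl (g := fun _ => (1 : ℝ)) fun i hi => if_neg (Finset.ne_of_mem_erase hi)]
    simp
  have hwr : ∑ c : γ, w (Sum.inr c) = 1 := by
    simp only [w, Sum.elim_inr, Finset.sum_const, Finset.card_univ, nsmul_eq_mul]
    exact mul_inv_cancel₀ hq0.ne'
  have hκ : (1 : ℝ) ≤ k := by exact_mod_cast hk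
  have hF : ∀ F : Finset (Fin (k + 1) ⊕ γ), (∀ B ∈ 𝒜, ¬ B ⊆ F) → ∑ b ∈ F, w b ≤ (k : ℝ) := by
    intro F hF
    by_cases hall : ∀ i, i ≠ i₀ → Sum.inl i ∈ F
    · have hr : ∀ c, Sum.inr c ∉ F := by
        intro c hc
        refine hF _ (Finset.mem_image_of_mem _ (Finset.mem_univ c)) ?_
        intro b hb
        obtain ⟨i, _, rfl⟩ := Finset.mem_image.1 hb
        by_cases hi : i = i₀
        · subst hi; simpa [e] using hc
        · simpa [e, Function.update_of_ne hi] using hall i hi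
      have hsub : F ⊆ Finset.univ.map Function.Embedding.inl := by
        rintro (i | c) hb
        · simp
        · exact absurd hb (hr c)
      calc ∑ b ∈ F, w b ≤ ∑ b ∈ Finset.univ.map Function.Embedding.inl, w b :=
            Finset.sum_le_sum_of_subset_of_nonneg hsub fun b _ _ => hw b
        _ = k := by rw [Finset.sum_map]; exact hwl
    · push Not at hall
      obtain ⟨i, hi, hiF⟩ := hall
      have hsub : F ⊆ Finset.univ.erase (Sum.inl i) := fun b hb =>
        Finset.mem_erase.2 ⟨fun hbi => hiF (hbi ▸ hb), Finset.mem_univ _⟩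
      have h1 : w (Sum.inl i) + ∑ b ∈ Finset.univ.erase (Sum.inl i), w b = k + 1 := by
        rw [Finset.add_sum_erase _ _ (Finset.mem_univ _), Fintype.sum_sum_type, hwl, hwr]
      have h2 : w (Sum.inl i) = 1 := if_neg hi
      have h3 := Finset.sum_le_sum_of_subset_of_nonneg hsub fun b _ _ => hw b
      linarith
  have h𝒜 : ∀ B ∈ 𝒜, ∃ a ∈ B, ∃ b ∈ B, Disjoint (P a) (P b) := by
    intro B hB
    obtain ⟨c, _, rfl⟩ := Finset.mem_image.1 hB
    have hPA : ∀ i, P (e c i) ⊆ A i := by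
      intro i
      have := congrFun (hPe c) i
      rw [this]
      by_cases hi : i = i₀
      · subst hi; simp
      · simp [Function.update_of_ne hi]
    refine ⟨e c 0, Finset.mem_image_of_mem _ (Finset.mem_univ _), e c (Fin.last k),
      Finset.mem_image_of_mem _ (Finset.mem_univ _), (hA ?_).mono (hPA _) (hPA _)⟩
    intro h0
    have := congrArg Fin.val h0
    simp at this
    omega
  have hno : ∀ B ∈ 𝒜, ¬ ArbIndepOn α P (B : Set (Fin (k + 1) ⊕ γ)) := by
    intro B hB hind
    obtain ⟨c, _, rfl⟩ := Finset.mem_image.1 hB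
    refine hcon c ?_
    rw [← hPe c]
    exact hind.hasArbLargeIndep (e c) fun i =>
      Finset.mem_coe.2 (Finset.mem_image_of_mem _ (Finset.mem_univ _))
  obtain ⟨d, hd⟩ := exists_sum_prod_le_of_not_arbIndepOn α P 𝒜 h𝒜 hno w hw hκ hF le_rfl
  have hM : 0 ≤ 𝒜.card * ∑ b, w b :=
    mul_nonneg (by positivity) (Finset.sum_nonneg fun b _ => hw b)
  have hlt : (k : ℝ) < k + q⁻¹ := by
    have : 0 < q⁻¹ := by positivity
    linarith
  obtain ⟨n, hn, hn1⟩ := ((eventually_mul_pow_mul_pow_lt (c := 1) (by linarith) hlt hM d).and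
    (eventually_ge_atTop 1)).exists
  rw [one_mul] at hn
  obtain ⟨g, hg⟩ := h.exists_fin (n := n) (by omega)
  choose x hx using hg
  choose c hc using hC
  let f : (Fin n → Fin (k + 1)) → Fin n → Fin (k + 1) ⊕ γ := fun ω i =>
    if ω i = i₀ then Sum.inr (c (α (g i) (x ω))) else Sum.inl (ω i)
  have hf : Function.Injective f := by
    intro ω ω' hωω'
    funext i
    have := congrFun hωω' i
    simp only [f] at this
    split_ifs at this with h1 h2
    · rw [h1, h2]
    · exact Sum.inl_injective this
  have hreal : ∀ s ∈ Finset.univ.image f, ∃ x, ∀ i, α (g i) x ∈ P (s i) := by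
    intro s hs
    obtain ⟨ω, _, rfl⟩ := Finset.mem_image.1 hs
    refine ⟨x ω, fun i => ?_⟩
    have h1 := hx ω i
    simp only [f]
    split_ifs with h2
    · exact ⟨h2 ▸ h1, hc _⟩
    · exact h1
  have hle := hd n g _ hreal
  refine absurd hn (not_lt.2 (le_trans (le_of_eq ?_) hle))
  rw [Finset.sum_image fun _ _ _ _ h => hf h]
  let v : Fin (k + 1) → ℝ := fun i => if i = i₀ then q⁻¹ else 1
  have hv : ∑ i, v i = k + q⁻¹ := by
    simp only [v]
    rw [← Finset.add_sum_erase _ _ (Finset.mem_univ i₀), if_pos rfl,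
      Finset.sum_congr rfl (g := fun _ => (1 : ℝ)) fun i hi => if_neg (Finset.ne_of_mem_erase hi)]
    simp [add_comm]
  rw [← hv, Fintype.sum_pow]
  refine Finset.sum_congr rfl fun ω _ => Finset.prod_congr rfl fun i _ => ?_
  simp only [v, f]
  split_ifs with h1
  · rfl
  · exact (if_neg h1).symm

theorem HasArbLargeIndep.exists_inter {α : G → X → X} {k : ℕ} (hk : 1 ≤ k)
    {A : Fin (k + 1) → Set X} (hA : Pairwise fun i j => Disjoint (A i) (A j))
    (h : HasArbLargeIndep α A) {γ : Type*} [Fintype γ] (C : γ → Set X)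
    (hC : ∀ x, ∃ c, x ∈ C c) :
    ∃ c : Fin (k + 1) → γ, HasArbLargeIndep α fun i => A i ∩ C (c i) := by
  have key : ∀ s : Finset (Fin (k + 1)), ∃ c : Fin (k + 1) → γ,
      HasArbLargeIndep α fun i => if i ∈ s then A i ∩ C (c i) else A i := by
    intro s
    induction s using Finset.induction_on with
    | empty =>
      obtain ⟨x, _⟩ := h.nonempty 0
      obtain ⟨c, _⟩ := hC x
      exact ⟨fun _ => c, by simpa using h⟩
    | insert i₀ s hi₀ ih =>
      obtain ⟨c, hc⟩ := ih
      have hsub : ∀ i, (if i ∈ s then A i ∩ C (c i) else A i) ⊆ A i := fun i => by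
        split_ifs
        · exact Set.inter_subset_left
        · exact subset_rfl
      obtain ⟨c₀, hc₀⟩ := hc.exists_update hk
        (fun i j hij => (hA hij).mono (hsub i) (hsub j)) C hC i₀
      refine ⟨Function.update c i₀ c₀, hc₀.mono fun i => ?_⟩
      by_cases hi : i = i₀
      · subst hi; simp [hi₀]
      · simp [Finset.mem_insert, hi]
  obtain ⟨c, hc⟩ := key Finset.univ
  exact ⟨c, by simpa using hc⟩

/-- Separated sets with arbitrarily large independence sets produce an intrinsic IN-tuple. -/
theorem HasArbLargeIndep.exists_isINTuple [MetricSpace X] [CompactSpace X] {α : G → X → X}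
    {k : ℕ} (hk : 1 ≤ k) {A : Fin (k + 1) → Set X} {η : ℝ} (hη : 0 < η)
    (hA : ∀ i j, i ≠ j → ∀ x ∈ A i, ∀ y ∈ A j, η ≤ dist x y) (h : HasArbLargeIndep α A) :
    ∃ x : Fin (k + 1) → X, IsINTuple α x ∧ Function.Injective x := by
  have hdisj : Pairwise fun i j => Disjoint (A i) (A j) := fun i j hij =>
    Set.disjoint_left.2 fun x hx hx' => by
      have := hA i j hij x hx x hx'
      rw [dist_self] at this
      linarith
  have key : ∀ ε : ℝ, 0 < ε → ∃ z : Fin (k + 1) → X, (∀ i, z i ∈ A i) ∧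
      HasArbLargeIndep α fun i => Metric.ball (z i) ε := by
    intro ε hε
    obtain ⟨t, _, htf, ht⟩ := finite_cover_balls_of_compact
      (isCompact_univ (X := X)) (half_pos hε)
    have : Fintype t := htf.fintype
    obtain ⟨c, hc⟩ := h.exists_inter hk hdisj (fun c : t => Metric.ball (c : X) (ε / 2)) fun x => by
      obtain ⟨c, hc, hx⟩ := Set.mem_iUnion₂.1 (ht (Set.mem_univ x))
      exact ⟨⟨c, hc⟩, hx⟩
    choose z hz using fun i => hc.nonempty i
    refine ⟨z, fun i => (hz i).1, hc.mono fun i y hy => ?_⟩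
    have h1 := Metric.mem_ball.1 (hz i).2
    have h2 := Metric.mem_ball.1 hy.2
    have h3 := dist_triangle_right y (z i) (c i)
    rw [Metric.mem_ball]
    linarith
  choose z hzA hz using fun n : ℕ => key (1 / ((n : ℝ) + 1)) Nat.one_div_pos_of_nat
  obtain ⟨x, φ, hφ, hx⟩ := CompactSpace.tendsto_subseq z
  have hx' := tendsto_pi_nhds.1 hx
  refine ⟨x, ?_, ?_⟩
  · intro U hU hxU
    have hev : ∀ i, ∀ᶠ n in atTop, Metric.ball (z (φ n) i) (1 / ((φ n : ℝ) + 1)) ⊆ U i := by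
      intro i
      obtain ⟨ε, hε, hεU⟩ := Metric.isOpen_iff.1 (hU i) _ (hxU i)
      have h1 := (Metric.tendsto_nhds.1 (hx' i)) (ε / 2) (half_pos hε)
      have h2 := (tendsto_one_div_add_atTop_nhds_zero_nat (𝕜 := ℝ)).comp hφ.tendsto_atTop
      filter_upwards [h1, h2.eventually (gt_mem_nhds (half_pos hε))] with n hn1 hn2
      refine subset_trans (fun y hy => ?_) hεU
      simp only [Function.comp_apply] at hn1 hn2
      have := dist_triangle y (z (φ n) i) (x i)
      rw [Metric.mem_ball] at hy ⊢
      linarith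
    obtain ⟨n, hn⟩ := (eventually_all.2 hev).exists
    exact (hz (φ n)).mono hn
  · intro i j hij
    by_contra hne
    have h1 : Tendsto (fun n => dist (z (φ n) i) (z (φ n) j)) atTop (𝓝 (dist (x i) (x j))) :=
      (hx' i).dist (hx' j)
    have h2 : η ≤ dist (x i) (x j) :=
      ge_of_tendsto' h1 fun n => hA i j hne _ (hzA _ i) _ (hzA _ j)
    rw [hij, dist_self] at h2
    linarith

end Splitting

section CoverCounting

variable {G X : Type*}

theorem coverN_le_card {𝒰 : Set (Set X)} {F : Finset (Set X)} (hF : ↑F ⊆ 𝒰)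
    (hU : ⋃₀ (F : Set (Set X)) = Set.univ) : coverN 𝒰 ≤ F.card :=
  Nat.sInf_le ⟨F, hF, rfl, hU⟩

theorem exists_card_eq_coverN {𝒰 : Set (Set X)} {F : Finset (Set X)} (hF : ↑F ⊆ 𝒰)
    (hU : ⋃₀ (F : Set (Set X)) = Set.univ) :
    ∃ F' : Finset (Set X), ↑F' ⊆ 𝒰 ∧ F'.card = coverN 𝒰 ∧
      ⋃₀ (F' : Set (Set X)) = Set.univ :=
  Nat.sInf_mem (s := {n : ℕ | ∃ F : Finset (Set X), (F : Set (Set X)) ⊆ 𝒰 ∧ F.card = n ∧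
    ⋃₀ (F : Set (Set X)) = Set.univ}) ⟨_, F, hF, rfl, hU⟩

theorem IsOpenCover.exists_finset [TopologicalSpace X] [CompactSpace X] {𝒰 : Set (Set X)}
    (h : IsOpenCover 𝒰) :
    ∃ F : Finset (Set X), ↑F ⊆ 𝒰 ∧ ⋃₀ (F : Set (Set X)) = Set.univ := by
  obtain ⟨t, ht⟩ := isCompact_univ.elim_finite_subcover (fun U : 𝒰 => (U : Set X))
    (fun U => h.1 U U.2) (by rw [← Set.sUnion_eq_iUnion, h.2])
  refine ⟨t.image Subtype.val, ?_, Set.eq_univ_of_forall fun x => ?_⟩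
  · intro U hU
    obtain ⟨V, _, rfl⟩ := Finset.mem_image.1 (Finset.mem_coe.1 hU)
    exact V.2
  · obtain ⟨V, hV, hx⟩ := Set.mem_iUnion₂.1 (ht (Set.mem_univ x))
    exact ⟨V, Finset.mem_coe.2 (Finset.mem_image_of_mem _ hV), hx⟩

theorem exists_finset_joinPull (α : G → X → X) {𝒰 : Set (Set X)} {F : Finset (Set X)}
    (hF : ↑F ⊆ 𝒰) (hU : ⋃₀ (F : Set (Set X)) = Set.univ) {n : ℕ} (g : Fin n → G) :
    ∃ F' : Finset (Set X), ↑F' ⊆ joinPull α 𝒰 g ∧ F'.card ≤ F.card ^ n ∧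
      ⋃₀ (F' : Set (Set X)) = Set.univ := by
  refine ⟨Finset.univ.image fun u : Fin n → F => ⋂ i, α (g i) ⁻¹' (u i : Set X), ?_, ?_,
    Set.eq_univ_of_forall fun x => ?_⟩
  · intro V hV
    obtain ⟨u, _, rfl⟩ := Finset.mem_image.1 (Finset.mem_coe.1 hV)
    exact ⟨fun i => u i, fun i => hF (u i).2, rfl⟩
  · refine Finset.card_image_le.trans ?_
    simp
  · have : ∀ i, ∃ V : F, α (g i) x ∈ (V : Set X) := fun i => by
      obtain ⟨V, hV, hx⟩ := hU.symm ▸ Set.mem_univ (α (g i) x)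
      exact ⟨⟨V, hV⟩, hx⟩
    choose u hu using this
    exact ⟨_, Finset.mem_coe.2 (Finset.mem_image_of_mem _ (Finset.mem_univ u)),
      Set.mem_iInter.2 hu⟩

theorem coverN_joinPull_le_patN [TopologicalSpace X] [CompactSpace X] (α : G → X → X)
    {𝒰 : Set (Set X)} (h : IsOpenCover 𝒰) {n : ℕ} (g : Fin n → G) :
    coverN (joinPull α 𝒰 g) ≤ patN α 𝒰 n := by
  obtain ⟨F, hF, hU⟩ := h.exists_finset
  refine le_csSup ⟨F.card ^ n, ?_⟩ ⟨g, rfl⟩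
  rintro _ ⟨g', rfl⟩
  obtain ⟨F', hF', hc, hU'⟩ := exists_finset_joinPull α hF hU g'
  exact (coverN_le_card hF' hU').trans hc

theorem patN_le {α : G → X → X} {𝒰 : Set (Set X)} {n c : ℕ}
    (h : ∀ g : Fin n → G, coverN (joinPull α 𝒰 g) ≤ c) : patN α 𝒰 n ≤ c := by
  refine csSup_le' ?_
  rintro _ ⟨g, rfl⟩
  exact h g

end CoverCounting

section LowerBound

variable {G X : Type*}

theorem ofReal_log_le_patEnt [MetricSpace X] [CompactSpace X] {α : G → X → X} {k : ℕ}
    {x : Fin k → X} (hx : IsINTuple α x) (hinj : Function.Injective x) (hk : 1 ≤ k) :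
    ENNReal.ofReal (Real.log k) ≤ patEnt α := by
  have hev : ∀ᶠ ε in 𝓝[>] (0 : ℝ), ∀ i j, i ≠ j → ε < dist (x i) (x j) / 4 := by
    refine eventually_all.2 fun i => eventually_all.2 fun j => ?_
    by_cases hij : i = j
    · simp [hij]
    · have : 0 < dist (x i) (x j) / 4 := by
        have := dist_pos.2 (hinj.ne hij)
        positivity
      filter_upwards [nhdsWithin_le_nhds (gt_mem_nhds this)] with ε hε _ using hε
  obtain ⟨ε, hε, hε0⟩ := (hev.and self_mem_nhdsWithin).exists
  have hε0 : 0 < ε := hε0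
  set 𝒰 : Set (Set X) := Set.range fun y => Metric.ball y ε with h𝒰
  have hcov : IsOpenCover 𝒰 := by
    refine ⟨?_, Set.eq_univ_of_forall fun y => ⟨_, ⟨y, rfl⟩, Metric.mem_ball_self hε0⟩⟩
    rintro _ ⟨y, rfl⟩
    exact Metric.isOpen_ball
  have hsep : ∀ U ∈ 𝒰, ∀ i j, ∀ y ∈ U, ∀ z ∈ U, y ∈ Metric.ball (x i) ε →
      z ∈ Metric.ball (x j) ε → i = j := by
    rintro _ ⟨c, rfl⟩ i j y hy z hz hyi hzj
    by_contra hij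
    have h0 := hε i j hij
    rw [Metric.mem_ball] at hy hz hyi hzj
    have h1 := dist_triangle_left (x i) c y
    have h2 := dist_triangle_left (x j) c z
    have h3 := dist_triangle_right (x i) (x j) c
    linarith
  have hind := hx (fun i => Metric.ball (x i) ε) (fun i => Metric.isOpen_ball)
    fun i => Metric.mem_ball_self hε0
  have hpat : ∀ n : ℕ, 1 ≤ n → k ^ n ≤ patN α 𝒰 n := by
    intro n hn
    obtain ⟨g, hg⟩ := hind.exists_fin (n := n) (by omega)
    refine le_trans ?_ (coverN_joinPull_le_patN α hcov g)
    obtain ⟨F, hF, hU⟩ := hcov.exists_finset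
    obtain ⟨F', hF', _, hU'⟩ := exists_finset_joinPull α hF hU g
    obtain ⟨F'', hF'', hc, hU''⟩ := exists_card_eq_coverN hF' hU'
    rw [← hc]
    choose z hz using hg
    have : ∀ ω, ∃ V ∈ F'', z ω ∈ V := fun ω => by
      obtain ⟨V, hV, hzV⟩ := hU''.symm ▸ Set.mem_univ (z ω)
      exact ⟨V, hV, hzV⟩
    choose V hV hzV using this
    have hcard : (Finset.univ : Finset (Fin n → Fin k)).card ≤ F''.card := by
      refine Finset.card_le_card_of_injOn V (fun ω _ => hV ω) fun ω _ ω' _ hωω' => ?_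
      funext i
      obtain ⟨u, hu, hVu⟩ := hF'' (hV ω)
      have h1 := hzV ω
      have h2 := hωω' ▸ hzV ω'
      rw [hVu, Set.mem_iInter] at h1 h2
      exact hsep _ (hu i) _ _ _ (h1 i) _ (h2 i) (hz ω i) (hz ω' i)
    simpa using hcard
  refine le_trans ?_ (le_iSup₂ (f := fun 𝒰 (_ : 𝒰 ∈ {𝒰 : Set (Set X) | IsOpenCover 𝒰}) =>
    patEntCover α 𝒰) 𝒰 hcov)
  refine Filter.le_limsup_of_frequently_le (Eventually.frequently ?_)
  filter_upwards [eventually_ge_atTop 1] with n hn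
  refine ENNReal.ofReal_le_ofReal ?_
  have hn0 : (0 : ℝ) < n := by exact_mod_cast hn
  have hk0 : (0 : ℝ) < k := by exact_mod_cast hk
  rw [le_div_iff₀ hn0, mul_comm, ← Real.log_pow]
  exact Real.log_le_log (by positivity) (by exact_mod_cast hpat n hn)

end LowerBound

section UpperBound

variable {G X : Type*}

/-- Partitions `P 0, …, P (L - 1)` subordinate to `𝒰` whose cells `(j, true)` are uniformly
separated; each point lies in the exceptional cells `(j, false)` of at most `m` of them, with `m`
independent of `L`. -/
theorem IsOpenCover.exists_separated_cells [MetricSpace X] [CompactSpace X] {𝒰 : Set (Set X)}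
    (h : IsOpenCover 𝒰) : ∃ (m : ℕ) (U : Fin m → Set X), (∀ j, U j ∈ 𝒰) ∧
      ∀ L : ℕ, 1 ≤ L → ∃ η : ℝ, 0 < η ∧ ∃ P : Fin L → Fin m × Bool → Set X,
        (∀ l s, P l s ⊆ U s.1) ∧ (∀ l x, ∃ s, x ∈ P l s) ∧
        (∀ l j j', j ≠ j' → ∀ x ∈ P l (j, true), ∀ y ∈ P l (j', true), η ≤ dist x y) ∧
        ∀ x, (Finset.univ.filter fun l => ∃ j, x ∈ P l (j, false)).card ≤ m := by
  obtain ⟨δ, hδ, hδU⟩ := lebesgue_number_lemma_of_metric_sUnion (isCompact_univ (X := X)) h.1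
    h.2.ge
  obtain ⟨t, _, htf, ht⟩ := finite_cover_balls_of_compact
    (isCompact_univ (X := X)) (half_pos hδ)
  have : Fintype t := htf.fintype
  set m := Fintype.card t
  let p : Fin m → X := fun j => (Fintype.equivFin t).symm j
  have hp : ∀ x, ∃ j, dist x (p j) < δ / 2 := by
    intro x
    obtain ⟨c, hc, hx⟩ := Set.mem_iUnion₂.1 (ht (Set.mem_univ x))
    exact ⟨Fintype.equivFin t ⟨c, hc⟩, by simpa [p] using hx⟩
  choose U hU hUb using fun j => hδU (p j) (Set.mem_univ _)
  refine ⟨m, U, hU, fun L hL => ?_⟩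
  have hL0 : (0 : ℝ) < L := by exact_mod_cast hL
  set η : ℝ := δ / 4 / L with hη
  have hη0 : 0 < η := by positivity
  have hηL : η * L = δ / 4 := by rw [hη]; field_simp
  set r : Fin L → ℝ := fun l => δ / 2 + 2 * η * (l : ℕ) with hr
  have hrδ : ∀ l, r l ≤ δ := by
    intro l
    have : ((l : ℕ) : ℝ) ≤ L := by exact_mod_cast l.2.le
    have := mul_le_mul_of_nonneg_left this hη0.le
    simp only [hr]; linarith
  have hrδ' : ∀ l, δ / 2 ≤ r l := by
    intro l
    simp only [hr]
    have : 0 ≤ 2 * η * ((l : ℕ) : ℝ) := by positivity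
    linarith
  have hrr : ∀ l l' : Fin L, l < l' → r l + 2 * η ≤ r l' := by
    intro l l' hl
    have : ((l : ℕ) : ℝ) + 1 ≤ (l' : ℕ) := by exact_mod_cast hl
    have := mul_le_mul_of_nonneg_left this hη0.le
    simp only [hr]; linarith
  let P : Fin L → Fin m × Bool → Set X := fun l s =>
    {x | dist x (p s.1) < r l ∧ (∀ j' < s.1, r l ≤ dist x (p j')) ∧
      (s.2 = true ↔ ∀ j', η ≤ |dist x (p j') - r l|)}
  refine ⟨η, hη0, P, ?_, ?_, ?_, ?_⟩
  · intro l s x hx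
    exact hUb _ (Metric.mem_ball.2 (hx.1.trans_le (hrδ l)))
  · intro l x
    obtain ⟨j, hj, hmin⟩ := WellFounded.has_min (wellFounded_lt (α := Fin m))
      {j | dist x (p j) < r l} (by
        obtain ⟨j, hj⟩ := hp x
        exact ⟨j, hj.trans_le (hrδ' l)⟩)
    refine ⟨(j, decide (∀ j', η ≤ |dist x (p j') - r l|)), hj, fun j' hj' => ?_, by simp⟩
    by_contra hcon
    exact hmin j' (not_le.1 hcon) hj'
  · intro l
    have key : ∀ j j', j < j' → ∀ x y, dist x (p j) < r l → (∀ j', η ≤ |dist x (p j') - r l|) →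
        (∀ i < j', r l ≤ dist y (p i)) → η ≤ dist x y := by
      intro j j' hjj' x y hx hxη hy
      have h1 := hxη j
      rw [abs_of_neg (by linarith)] at h1
      have h2 := hy j hjj'
      have h3 := dist_triangle_left y (p j) x
      linarith
    intro j j' hjj' x hx y hy
    rcases lt_or_gt_of_ne hjj' with hlt | hlt
    · exact key j j' hlt x y hx.1 (hx.2.2.1 rfl) hy.2.1
    · rw [dist_comm]
      exact key j' j hlt y x hy.1 (hy.2.2.1 rfl) hx.2.1
  · intro x
    have hex : ∀ l, ∃ j', l ∈ (Finset.univ.filter fun l => ∃ j, x ∈ P l (j, false)) →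
        |dist x (p j') - r l| < η := by
      intro l
      by_cases hl : ∃ j', |dist x (p j') - r l| < η
      · obtain ⟨j', hj'⟩ := hl
        exact ⟨j', fun _ => hj'⟩
      · push Not at hl
        obtain ⟨j, _⟩ := hp x
        refine ⟨j, fun hmem => ?_⟩
        obtain ⟨_, hj⟩ := (Finset.mem_filter.1 hmem).2
        exact absurd (hj.2.2.2 hl) (by simp)
    choose f hf using hex
    have hcard := Finset.card_le_card_of_injOn (t := (Finset.univ : Finset (Fin m))) f
      (fun l _ => Finset.mem_coe.2 (Finset.mem_univ _))
      (s := Finset.univ.filter fun l => ∃ j, x ∈ P l (j, false)) (by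
      intro l hl l' hl' hll'
      have h1 := abs_lt.1 (hf l hl)
      have h2 := abs_lt.1 (hf l' hl')
      rw [← hll'] at h2
      by_contra hne
      rcases lt_or_gt_of_ne hne with hlt | hlt
      · have := hrr _ _ hlt
        linarith
      · have := hrr _ _ hlt
        linarith)
    rw [Finset.card_univ, Fintype.card_fin] at hcard
    convert hcard

theorem eventually_coverN_joinPull_le [MetricSpace X] [CompactSpace X] {α : G → X → X} {k : ℕ}
    (hk : 1 ≤ k) (hno : ¬ ∃ x : Fin (k + 1) → X, IsINTuple α x ∧ Function.Injective x)
    {𝒰 : Set (Set X)} (h : IsOpenCover 𝒰) {v : ℝ} (hv : k < v) :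
    ∀ᶠ n : ℕ in atTop, ∀ g : Fin n → G, (coverN (joinPull α 𝒰 g) : ℝ) ≤ v ^ n := by
  obtain ⟨m, U, hU, hcells⟩ := h.exists_separated_cells
  have hk1 : (1 : ℝ) ≤ k := by exact_mod_cast hk
  obtain ⟨θ, hθ0, hθ1, hθv⟩ : ∃ θ : ℝ, 0 < θ ∧ θ ≤ 1 ∧ k + m * θ < v := by
    have hcont : Tendsto (fun θ : ℝ => k + m * θ) (𝓝[>] 0) (𝓝 (k + m * 0)) :=
      ((continuous_const.add (continuous_const.mul continuous_id)).tendsto 0).mono_left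
        nhdsWithin_le_nhds
    have h1 := hcont.eventually (gt_mem_nhds (by simpa using hv))
    have h2 : ∀ᶠ θ : ℝ in 𝓝[>] 0, θ < 1 := nhdsWithin_le_nhds (gt_mem_nhds one_pos)
    obtain ⟨θ, ⟨h1, h2⟩, h3⟩ := ((h1.and h2).and self_mem_nhdsWithin).exists
    exact ⟨θ, h3, h2.le, h1⟩
  set κ : ℝ := k + m * θ with hκ
  have hκ1 : 1 ≤ κ := by
    have : 0 ≤ m * θ := by positivity
    linarith
  have hκ0 : 0 < κ := by linarith
  obtain ⟨u, hu1, huv⟩ := exists_between ((one_lt_div hκ0).2 hθv)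
  rw [lt_div_iff₀ hκ0] at huv
  have hu0 : 0 < u := by linarith
  obtain ⟨L, hLu, hL⟩ := (((tendsto_pow_atTop_atTop_of_one_lt hu1).eventually_ge_atTop
    (θ ^ m)⁻¹).and (eventually_ge_atTop 1)).exists
  have huθ : 1 ≤ u ^ L * θ ^ m := by
    rwa [inv_le_iff_one_le_mul₀ (by positivity)] at hLu
  obtain ⟨η, hη, P, hPU, hPc, hPs, hPm⟩ := hcells L hL
  let good : Finset (Fin m × Bool) := Finset.univ.filter fun s => s.2 = true
  let 𝒜 := good.powersetCard (k + 1)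
  let w : Fin m × Bool → ℝ := fun s => if s.2 = false then θ else 1
  have hw : ∀ s, 0 ≤ w s := fun s => by
    simp only [w]; split_ifs <;> positivity
  have hF : ∀ F : Finset (Fin m × Bool), (∀ A ∈ 𝒜, ¬ A ⊆ F) → ∑ s ∈ F, w s ≤ κ := by
    intro F hF
    have h1 : (F.filter fun s => s.2 ≠ false).card ≤ k := by
      by_contra hcon
      obtain ⟨A, hA, hcard⟩ := Finset.exists_subset_card_eq (not_le.1 hcon)
      refine hF A (Finset.mem_powersetCard.2 ⟨fun s hs => ?_, hcard⟩)
        (hA.trans (Finset.filter_subset _ _))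
      have := (Finset.mem_filter.1 (hA hs)).2
      simpa [good] using this
    have h2 : (F.filter fun s => s.2 = false).card ≤ m := by
      have := Finset.card_le_card_of_injOn (t := (Finset.univ : Finset (Fin m))) Prod.fst
        (s := F.filter fun s => s.2 = false) (fun _ _ => Finset.mem_coe.2 (Finset.mem_univ _)) (by
        intro s hs s' hs' hss'
        exact Prod.ext hss' ((Finset.mem_filter.1 hs).2.trans (Finset.mem_filter.1 hs').2.symm))
      rwa [Finset.card_univ, Fintype.card_fin] at this
    simp only [w]
    rw [Finset.sum_ite, Finset.sum_const, Finset.sum_const, nsmul_eq_mul, nsmul_eq_mul, mul_one]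
    have h1' : ((F.filter fun s => ¬ s.2 = false).card : ℝ) ≤ k := by exact_mod_cast h1
    have h2' : ((F.filter fun s => s.2 = false).card : ℝ) ≤ m := by exact_mod_cast h2
    have := mul_le_mul_of_nonneg_right h2' hθ0.le
    linarith
  have hsep : ∀ l, ∀ s ∈ good, ∀ s' ∈ good, s ≠ s' → ∀ x ∈ P l s, ∀ y ∈ P l s',
      η ≤ dist x y := by
    rintro l ⟨j, b⟩ hs ⟨j', b'⟩ hs' hne x hx y hy
    obtain rfl : b = true := (Finset.mem_filter.1 hs).2
    obtain rfl : b' = true := (Finset.mem_filter.1 hs').2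
    exact hPs l j j' (fun hj => hne (by rw [hj])) x hx y hy
  have hA2 : ∀ l, ∀ A ∈ 𝒜, ∃ a ∈ A, ∃ b ∈ A, Disjoint (P l a) (P l b) := by
    intro l A hA
    obtain ⟨hAg, hAc⟩ := Finset.mem_powersetCard.1 hA
    obtain ⟨a, ha, b, hb, hab⟩ := Finset.one_lt_card.1 (by omega : 1 < A.card)
    refine ⟨a, ha, b, hb, Set.disjoint_left.2 fun x hx hx' => ?_⟩
    have := hsep l a (hAg ha) b (hAg hb) hab x hx x hx'
    rw [dist_self] at this
    linarith
  have hnoA : ∀ l, ∀ A ∈ 𝒜, ¬ ArbIndepOn α (P l) (A : Set (Fin m × Bool)) := by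
    intro l A hA hind
    obtain ⟨hAg, hAc⟩ := Finset.mem_powersetCard.1 hA
    let e := A.equivFinOfCardEq hAc
    refine hno (HasArbLargeIndep.exists_isINTuple hk hη (A := fun i => P l (e.symm i)) ?_
      (hind.hasArbLargeIndep (fun i => (e.symm i : Fin m × Bool)) fun i => (e.symm i).2))
    intro i j hij x hx y hy
    refine hsep l _ (hAg (e.symm i).2) _ (hAg (e.symm j).2) (fun hne => hij ?_) x hx y hy
    exact e.symm.injective (Subtype.ext hne)
  choose d hd using fun l => exists_sum_prod_le_of_not_arbIndepOn α (P l) 𝒜 (hA2 l) (hnoA l) w hw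
    hκ1 hF le_rfl
  set M : ℝ := 𝒜.card * ∑ b, w b with hM
  have hM0 : 0 ≤ M := mul_nonneg (by positivity) (Finset.sum_nonneg fun b _ => hw b)
  set D := ∑ l, d l with hD
  filter_upwards [eventually_mul_pow_mul_pow_lt (c := L) (mul_pos hu0 hκ0) huv hM0 D] with n hn g
  refine le_trans ?_ hn.le
  let S : Fin L → Finset (Fin n → Fin m × Bool) := fun l => Finset.univ.filter fun s =>
    (∃ x, ∀ i, α (g i) x ∈ P l (s i)) ∧
      (Finset.univ.filter fun i => (s i).2 = false).card * L ≤ m * n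
  have hScard : ∀ l, ((S l).card : ℝ) ≤ (u * κ) ^ n * (1 + M * n) ^ D := by
    intro l
    have h1 : ∀ s ∈ S l, 1 ≤ u ^ n * ∏ i, w (s i) := by
      intro s hs
      have hst := (Finset.mem_filter.1 hs).2.2
      set c := (Finset.univ.filter fun i => (s i).2 = false).card with hc
      have hprod : ∏ i, w (s i) = θ ^ c := by
        simp only [w]
        rw [Finset.prod_ite, Finset.prod_const, Finset.prod_const, one_pow, mul_one]
      rw [hprod]
      rw [← one_le_pow_iff_of_nonneg (by positivity) (show L ≠ 0 by omega)]
      calc (1 : ℝ) ≤ (u ^ L * θ ^ m) ^ n := one_le_pow₀ huθ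
        _ = (u ^ n) ^ L * θ ^ (m * n) := by
            rw [mul_pow, ← pow_mul, ← pow_mul, ← pow_mul, mul_comm L n]
        _ ≤ (u ^ n) ^ L * θ ^ (c * L) := by
            gcongr ?_ * ?_
            exact pow_le_pow_of_le_one hθ0.le hθ1 hst
        _ = (u ^ n * θ ^ c) ^ L := by rw [mul_pow, ← pow_mul θ]
    calc ((S l).card : ℝ) = ∑ s ∈ S l, (1 : ℝ) := by simp
      _ ≤ ∑ s ∈ S l, u ^ n * ∏ i, w (s i) := Finset.sum_le_sum h1
      _ = u ^ n * ∑ s ∈ S l, ∏ i, w (s i) := (Finset.mul_sum _ _ _).symm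
      _ ≤ u ^ n * (κ ^ n * (1 + M * n) ^ d l) := by
          refine mul_le_mul_of_nonneg_left ?_ (by positivity)
          exact hd l n g (S l) fun s hs => (Finset.mem_filter.1 hs).2.1
      _ = (u * κ) ^ n * (1 + M * n) ^ d l := by rw [mul_pow]; exact (mul_assoc _ _ _).symm
      _ ≤ _ := by
          refine mul_le_mul_of_nonneg_left ?_ (by positivity)
          refine pow_le_pow_right₀ ?_ (Finset.single_le_sum (fun _ _ => Nat.zero_le _)
            (Finset.mem_univ l))
          have : 0 ≤ M * n := by positivity
          linarith
  have hcover : coverN (joinPull α 𝒰 g) ≤ ∑ l, (S l).card := by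
    let box : (Fin n → Fin m × Bool) → Set X := fun s => ⋂ i, α (g i) ⁻¹' U (s i).1
    refine (coverN_le_card (F := Finset.univ.biUnion fun l => (S l).image box) ?_ ?_).trans
      (Finset.card_biUnion_le.trans (Finset.sum_le_sum fun l _ => Finset.card_image_le))
    · intro V hV
      obtain ⟨l, _, hV⟩ := Finset.mem_biUnion.1 (Finset.mem_coe.1 hV)
      obtain ⟨s, _, rfl⟩ := Finset.mem_image.1 hV
      exact ⟨fun i => U (s i).1, fun i => hU _, rfl⟩
    · refine Set.eq_univ_of_forall fun x => ?_
      choose s hs using fun (l : Fin L) (i : Fin n) => hPc l (α (g i) x)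
      have hsum : ∑ l, (Finset.univ.filter fun i => (s l i).2 = false).card ≤ m * n := by
        simp_rw [Finset.card_filter]
        rw [Finset.sum_comm]
        simp_rw [← Finset.card_filter]
        calc _ ≤ ∑ i : Fin n, m := by
              refine Finset.sum_le_sum fun i _ => le_trans (Finset.card_le_card ?_)
                (hPm (α (g i) x))
              intro l hl
              have hl' := (Finset.mem_filter.1 hl).2
              refine Finset.mem_filter.2 ⟨Finset.mem_univ _, (s l i).1, ?_⟩
              rw [← hl']
              exact hs l i
          _ = m * n := by simp [mul_comm]
      obtain ⟨l, hl⟩ : ∃ l, (Finset.univ.filter fun i => (s l i).2 = false).card * L ≤ m * n := by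
        by_contra hcon
        push Not at hcon
        have hne : (Finset.univ : Finset (Fin L)).Nonempty := ⟨⟨0, hL⟩, Finset.mem_univ _⟩
        have h1 := Finset.sum_lt_sum_of_nonempty hne fun l _ => hcon l
        rw [Finset.sum_const, Finset.card_univ, Fintype.card_fin, smul_eq_mul, ← Finset.sum_mul,
          mul_comm L] at h1
        exact absurd hsum (not_le.2 (lt_of_mul_lt_mul_right h1 (Nat.zero_le _)))
      have hmem : s l ∈ S l := Finset.mem_filter.2 ⟨Finset.mem_univ _, ⟨x, hs l⟩, hl⟩
      exact ⟨box (s l), Finset.mem_coe.2 (Finset.mem_biUnion.2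
        ⟨l, Finset.mem_univ _, Finset.mem_image_of_mem _ hmem⟩),
        Set.mem_iInter.2 fun i => hPU l _ (hs l i)⟩
  calc (coverN (joinPull α 𝒰 g) : ℝ) ≤ ∑ l, ((S l).card : ℝ) := by exact_mod_cast hcover
    _ ≤ ∑ _l : Fin L, (u * κ) ^ n * (1 + M * n) ^ D := Finset.sum_le_sum fun l _ => hScard l
    _ = _ := by simp

theorem patEntCover_le_ofReal_log [MetricSpace X] [CompactSpace X] {α : G → X → X} {k : ℕ}
    (hk : 1 ≤ k) (hno : ¬ ∃ x : Fin (k + 1) → X, IsINTuple α x ∧ Function.Injective x)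
    {𝒰 : Set (Set X)} (h : IsOpenCover 𝒰) :
    patEntCover α 𝒰 ≤ ENNReal.ofReal (Real.log k) := by
  refine ENNReal.le_of_forall_pos_le_add fun ε hε _ => ?_
  have hk1 : (1 : ℝ) ≤ k := by exact_mod_cast hk
  have hk0 : (0 : ℝ) < k := by linarith
  have hε' : (0 : ℝ) < ε := by exact_mod_cast hε
  have hv : (k : ℝ) < k * Real.exp ε :=
    lt_mul_of_one_lt_right hk0 (Real.one_lt_exp_iff.2 hε')
  have hlog : Real.log (k * Real.exp ε) = Real.log k + ε := by
    rw [Real.log_mul hk0.ne' (Real.exp_pos _).ne', Real.log_exp]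
  have hbound : ENNReal.ofReal (Real.log k) + ε = ENNReal.ofReal (Real.log (k * Real.exp ε)) := by
    rw [hlog, ENNReal.ofReal_add (Real.log_nonneg hk1) hε'.le, ENNReal.ofReal_coe_nnreal]
  rw [hbound]
  refine Filter.limsup_le_of_le (h := ?_)
  filter_upwards [eventually_coverN_joinPull_le hk hno h hv, eventually_ge_atTop 1] with n hn hn1
  refine ENNReal.ofReal_le_ofReal ?_
  have hn0 : (0 : ℝ) < n := by exact_mod_cast hn1
  have hle : (patN α 𝒰 n : ℝ) ≤ (k * Real.exp ε) ^ n :=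
    (Nat.le_floor_iff (by positivity)).1 (patN_le fun g => Nat.le_floor (hn g))
  rw [div_le_iff₀ hn0, mul_comm, ← Real.log_pow]
  rcases Nat.eq_zero_or_pos (patN α 𝒰 n) with h0 | h0
  · rw [h0, Nat.cast_zero, Real.log_zero]
    exact Real.log_nonneg (one_le_pow₀ (by linarith))
  · exact Real.log_le_log (by exact_mod_cast h0) hle

end UpperBound

/-- Huang–Ye: `h*_top(X,G) = log(sup{k : INₖᵉ(X,G) ≠ ∅})`; in particular
`h*_top(X,G)` is `+∞` or `log k` for some `k ∈ ℕ`. -/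
theorem maximal_pattern_entropy_eq_log_sup_intrinsic_INTuples
    {G X : Type*} [Group G] [Countable G] [Infinite G] [MetricSpace X] [CompactSpace X]
    (α : G → X → X) (hα : IsActionBy α) :
    patEnt α = (⨆ k ∈ {k : ℕ | ∃ x : Fin k → X, IsINTuple α x ∧ Function.Injective x},
        ENNReal.ofReal (Real.log k)) ∧
      (patEnt α = ⊤ ∨ ∃ k : ℕ, patEnt α = ENNReal.ofReal (Real.log k)) := by
  set T : Set ℕ := {k : ℕ | ∃ x : Fin k → X, IsINTuple α x ∧ Function.Injective x} with hT
  have hlower : (⨆ k ∈ T, ENNReal.ofReal (Real.log k)) ≤ patEnt α := by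
    refine iSup₂_le fun k hk => ?_
    obtain ⟨x, hx, hinj⟩ := hk
    rcases Nat.eq_zero_or_pos k with rfl | hk0
    · simp
    · exact ofReal_log_le_patEnt hx hinj hk0
  by_cases hbdd : BddAbove T
  · have hne : T.Nonempty := ⟨0, Fin.elim0, fun U _ _ n => by
      obtain ⟨F, hF⟩ := Infinite.exists_subset_card_eq G n
      exact ⟨F, hF.ge, fun _ _ _ ω => (ω 1).elim0⟩, fun i => i.elim0⟩
    obtain ⟨K, hK, hmax⟩ : ∃ K ∈ T, ∀ k ∈ T, k ≤ K :=
      ⟨sSup T, Nat.sSup_mem hne hbdd, fun k hk => le_csSup hbdd hk⟩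
    have hlog : Real.log ((max K 1 : ℕ) : ℝ) = Real.log K := by
      rcases Nat.eq_zero_or_pos K with rfl | hK0
      · simp
      · rw [max_eq_left hK0]
    have hupper : patEnt α ≤ ENNReal.ofReal (Real.log K) := by
      rw [← hlog]
      refine iSup₂_le fun 𝒰 h𝒰 => patEntCover_le_ofReal_log (le_max_right _ _) ?_ h𝒰
      intro hex
      have := hmax _ hex
      omega
    have hKs : ENNReal.ofReal (Real.log K) ≤ ⨆ k ∈ T, ENNReal.ofReal (Real.log k) :=
      le_iSup₂ (f := fun k (_ : k ∈ T) => ENNReal.ofReal (Real.log k)) K hK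
    exact ⟨le_antisymm (hupper.trans hKs) hlower,
      Or.inr ⟨K, le_antisymm hupper (hKs.trans hlower)⟩⟩
  · have htop : (⨆ k ∈ T, ENNReal.ofReal (Real.log k)) = ⊤ := by
      refine ENNReal.eq_top_of_forall_nnreal_le fun r => ?_
      obtain ⟨N, hN⟩ := exists_nat_ge (Real.exp r)
      obtain ⟨k, hk, hNk⟩ := not_bddAbove_iff.1 hbdd N
      refine le_trans ?_ (le_iSup₂ (f := fun k (_ : k ∈ T) => ENNReal.ofReal (Real.log k)) k hk)
      rw [← ENNReal.ofReal_coe_nnreal]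
      refine ENNReal.ofReal_le_ofReal ?_
      rw [← Real.log_exp (r : ℝ)]
      refine Real.log_le_log (Real.exp_pos _) (hN.trans ?_)
      exact_mod_cast hNk.le
    have hpat : patEnt α = ⊤ := top_le_iff.1 (htop ▸ hlower)
    exact ⟨hpat.trans htop.symm, Or.inl hpat⟩
end

section
/- Let G be a countably infinite discrete group and H a subgroup of G such that KHK^{-1} ⊊ G for every nonempty finite subset K of G. If (X,H,α) is a topological dynamical system, then the co-induced system (X_H^G, G, α^{H\G}) is weak-mixing. -/
open Filter Topology Set
open scoped ENNReal Classical

/-- A nonempty open subset of a product contains all functions agreeing with one of its points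
on a suitable finite set of coordinates. -/
theorem IsOpen.exists_finset_forall_eq_mem {ι : Type*} {X : ι → Type*}
    [∀ i, TopologicalSpace (X i)] {U : Set (∀ i, X i)} (hU : IsOpen U) {u : ∀ i, X i}
    (hu : u ∈ U) : ∃ I : Finset ι, ∀ f : ∀ i, X i, (∀ i ∈ I, f i = u i) → f ∈ U := by
  obtain ⟨I, B, hB, hsub⟩ := isOpen_pi_iff.1 hU u hu
  refine ⟨I, fun f hf => hsub fun i hi => ?_⟩
  rw [hf i hi]
  exact (hB i hi).2

namespace CoInd

variable {G X : Type*} [Group G] {H : Subgroup G}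

theorem rmul_inv_rmul (g : G) (θ : RQ H) : rmul H g⁻¹ (rmul H g θ) = θ := by
  induction θ using Quotient.inductionOn' with
  | h a => simp [rmul]

/-- If `rmul H g` sends a coset `θ` to `η`, then `g` lies in `(s θ)⁻¹ H (s η)`. -/
theorem mul_mul_inv_mem_of_rmul_eq {s : RQ H → G} (hs : ∀ θ : RQ H, Quotient.mk'' (s θ) = θ)
    {g : G} {θ η : RQ H} (h : rmul H g θ = η) : s θ * g * (s η)⁻¹ ∈ H := by
  have h' : (Quotient.mk'' (s η) : RQ H) = Quotient.mk'' (s θ * g) := by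
    rw [hs, ← h]
    conv_lhs => rw [← hs θ]
    rfl
  exact QuotientGroup.rightRel_apply.1 (Quotient.eq''.1 h')

/-- Under the hypothesis that no finite `K` has `K H K⁻¹ = G`, every finite set of cosets can be
translated off itself. -/
theorem exists_forall_rmul_notMem
    (hH : ∀ K : Finset G, K.Nonempty →
      {g : G | ∃ k₁ ∈ K, ∃ k₂ ∈ K, ∃ h ∈ H, g = k₁ * h * k₂⁻¹} ≠ Set.univ)
    {s : RQ H → G} (hs : ∀ θ : RQ H, Quotient.mk'' (s θ) = θ) (A : Finset (RQ H)) :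
    ∃ g : G, ∀ θ ∈ A, rmul H g θ ∉ A := by
  obtain ⟨g, hg⟩ := (Set.ne_univ_iff_exists_notMem _).1
    (hH (insert 1 (A.image fun θ => (s θ)⁻¹)) (Finset.insert_nonempty _ _))
  refine ⟨g, fun θ hθ hη => hg ?_⟩
  exact ⟨_, Finset.mem_insert_of_mem (Finset.mem_image_of_mem _ hθ),
    _, Finset.mem_insert_of_mem (Finset.mem_image_of_mem _ hη),
    s θ * g * (s (rmul H g θ))⁻¹, mul_mul_inv_mem_of_rmul_eq hs rfl, by simp [mul_assoc]⟩

theorem exists_forall_coindAct_apply_eq [TopologicalSpace X] {α : ↥H → X → X}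
    (hα : IsActionBy α) (s : RQ H → G) (g : G) (θ : RQ H) (y : X) :
    ∃ x : X, ∀ f : RQ H → X, f (rmul H g θ) = x → coindAct H α s g f θ = y := by
  by_cases h : s θ * g * (s (rmul H g θ))⁻¹ ∈ H
  · refine ⟨α ⟨_, h⟩⁻¹ y, fun f hf => ?_⟩
    rw [coindAct, dif_pos h, hf, ← hα.2.1, mul_inv_cancel, hα.1]
  · exact ⟨y, fun f hf => by rw [coindAct, dif_neg h, hf]⟩

/-- If `rmul H g` moves `A` off itself, then the values of `f` and of its translate by `g` can be
prescribed independently on `A`. -/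
theorem exists_eqOn_coindAct_eqOn [TopologicalSpace X] {α : ↥H → X → X}
    (hα : IsActionBy α) (s : RQ H → G) {g : G} {A : Finset (RQ H)}
    (hg : ∀ θ ∈ A, rmul H g θ ∉ A) (u v : RQ H → X) :
    ∃ f : RQ H → X, (∀ θ ∈ A, f θ = v θ) ∧ ∀ θ ∈ A, coindAct H α s g f θ = u θ := by
  choose w hw using fun θ => exists_forall_coindAct_apply_eq hα s g θ (u θ)
  refine ⟨fun η => if η ∈ A then v η else w (rmul H g⁻¹ η), fun θ hθ => if_pos hθ,
    fun θ hθ => hw θ _ ?_⟩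
  rw [if_neg (hg θ hθ), rmul_inv_rmul]

end CoInd

/-- Dooley–Zhang: if `K H K⁻¹ ⊊ G` for every nonempty finite `K ⊆ G`, then the
co-induced system is weak-mixing. -/
theorem coinduced_weakMixing
    {G X : Type*} [Group G] [Countable G] [Infinite G] [MetricSpace X] [CompactSpace X]
    (H : Subgroup G)
    (hH : ∀ K : Finset G, K.Nonempty →
      {g : G | ∃ k₁ ∈ K, ∃ k₂ ∈ K, ∃ h ∈ H, g = k₁ * h * k₂⁻¹} ≠ Set.univ)
    (α : ↥H → X → X) (hα : IsActionBy α)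
    (s : CoInd.RQ H → G) (hs : CoInd.IsSection H s) :
    IsWeakMixing (CoInd.coindAct H α s) := by
  intro U₁ U₂ V₁ V₂ hU₁ hU₂ hV₁ hV₂ ⟨u₁, hu₁⟩ ⟨u₂, hu₂⟩ ⟨v₁, hv₁⟩ ⟨v₂, hv₂⟩
  obtain ⟨I₁, hI₁⟩ := hU₁.exists_finset_forall_eq_mem hu₁
  obtain ⟨I₂, hI₂⟩ := hU₂.exists_finset_forall_eq_mem hu₂
  obtain ⟨J₁, hJ₁⟩ := hV₁.exists_finset_forall_eq_mem hv₁
  obtain ⟨J₂, hJ₂⟩ := hV₂.exists_finset_forall_eq_mem hv₂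
  obtain ⟨g, hg⟩ := CoInd.exists_forall_rmul_notMem hH hs.1 (I₁ ∪ I₂ ∪ (J₁ ∪ J₂))
  obtain ⟨f₁, hfv₁, hfu₁⟩ := CoInd.exists_eqOn_coindAct_eqOn hα s hg u₁ v₁
  obtain ⟨f₂, hfv₂, hfu₂⟩ := CoInd.exists_eqOn_coindAct_eqOn hα s hg u₂ v₂
  exact ⟨g,
    ⟨_, hI₁ _ fun θ hθ => hfu₁ θ (by simp [hθ]), f₁, hJ₁ _ fun θ hθ => hfv₁ θ (by simp [hθ]), rfl⟩,
    ⟨_, hI₂ _ fun θ hθ => hfu₂ θ (by simp [hθ]), f₂, hJ₂ _ fun θ hθ => hfv₂ θ (by simp [hθ]), rfl⟩⟩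
end

section
/- Let (X,G,α) be a topological dynamical system and H ≤ G a subgroup of finite index. Then for every k ∈ ℕ, IN_k(X,G) = IN_k(X,H), where the right-hand side is computed for the restricted H-action. -/
open Filter Topology Set
open scoped ENNReal Classical

/-- Independence sets pull back along an injection of index sets, up to moving the base point. -/
theorem IsIndepSet.preimage {G K X : Type*} {α : G → X → X} {β : K → X → X} {k : ℕ}
    {A : Fin k → Set X} {I : Set G} (hI : IsIndepSet α A I) {f : K → G}
    (hf : Function.Injective f) (e : X → X) (he : ∀ a x, β a (e x) = α (f a) x) :
    IsIndepSet β A (f ⁻¹' I) := by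
  intro F hF hne ω
  obtain ⟨a₀, -⟩ := id hne
  obtain ⟨x, hx⟩ := hI (F.image f) (by simpa [Set.image_subset_iff] using hF) (hne.image f)
    (Function.extend f ω fun _ => ω a₀)
  refine ⟨e x, ?_⟩
  simp only [Set.mem_iInter, Set.mem_preimage] at hx ⊢
  intro a ha
  have h := hx (f a) (Finset.mem_image_of_mem f ha)
  rwa [hf.extend_apply, ← he] at h

/-- Independence sets of a reindexed action push forward along the reindexing map. -/
theorem IsIndepSet.image {G K X : Type*} {α : G → X → X} {k : ℕ} {A : Fin k → Set X}
    {J : Set K} {f : K → G} (hf : Function.Injective f)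
    (hJ : IsIndepSet (fun a => α (f a)) A J) : IsIndepSet α A (f '' J) := by
  intro F hF hne ω
  have hmem : ∀ g ∈ F, ∃ a ∈ J, f a = g := fun g hg => hF hg
  obtain ⟨x, hx⟩ := hJ (F.preimage f hf.injOn)
    (fun a ha => by
      obtain ⟨b, hb, hba⟩ := hmem (f a) (by simpa using ha)
      exact hf hba ▸ hb)
    (by
      obtain ⟨g, hg⟩ := hne
      obtain ⟨a, -, rfl⟩ := hmem g hg
      exact ⟨a, by simpa using hg⟩)
    (ω ∘ f)
  refine ⟨x, ?_⟩
  simp only [Set.mem_iInter, Set.mem_preimage, Finset.mem_preimage] at hx ⊢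
  intro g hg
  obtain ⟨a, -, rfl⟩ := hmem g hg
  exact hx a hg

/-- Some right coset of a finite-index subgroup contains a proportional part of a finite set. -/
theorem Subgroup.exists_le_card_preimage_mul_right {G : Type*} [Group G] (H : Subgroup G)
    (hH : H.index ≠ 0) (n : ℕ) (F : Finset G) (hF : H.index * n ≤ F.card) :
    ∃ g : G, n ≤ (F.preimage (fun h : H => (h : G) * g)
      ((mul_left_injective g).comp Subtype.val_injective).injOn).card := by
  have : H.FiniteIndex := ⟨hH⟩
  let := Fintype.ofFinite (G ⧸ H)
  obtain ⟨y, -, hy⟩ := Finset.exists_le_card_fiber_of_mul_le_card_of_maps_to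
    (s := F) (t := Finset.univ) (f := fun a : G => (QuotientGroup.mk a⁻¹ : G ⧸ H)) (n := n)
    (fun _ _ => Finset.mem_univ _) Finset.univ_nonempty
    (by rwa [Finset.card_univ, ← Nat.card_eq_fintype_card])
  obtain ⟨g, rfl⟩ := QuotientGroup.mk_surjective y
  refine ⟨g⁻¹, hy.trans ?_⟩
  rw [Finset.card_preimage]
  refine Finset.card_le_card fun a ha => ?_
  rw [Finset.mem_filter] at ha ⊢
  refine ⟨ha.1, ⟨a * g, ?_⟩, by simp⟩
  simpa using QuotientGroup.eq.mp ha.2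

/-- Proposition 3.1: if `[G:H] < ∞` then `INₖ(X,G) = INₖ(X,H)`. -/
theorem INTuples_eq_of_finiteIndex
    {G X : Type*} [Group G] [Countable G] [Infinite G] [MetricSpace X] [CompactSpace X]
    (α : G → X → X) (hα : IsActionBy α) (H : Subgroup G) (hH : H.index ≠ 0) (k : ℕ) :
    {x : Fin k → X | IsINTuple α x}
      = {x : Fin k → X | IsINTuple (fun (h : ↥H) (y : X) => α ↑h y) x} := by
  ext x
  refine ⟨fun hx U hU hxU n => ?_, fun hx U hU hxU n => ?_⟩
  · obtain ⟨F, hcard, hF⟩ := hx U hU hxU (H.index * n)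
    obtain ⟨g, hg⟩ := H.exists_le_card_preimage_mul_right hH n F hcard
    refine ⟨_, hg, ?_⟩
    rw [Finset.coe_preimage]
    exact hF.preimage ((mul_left_injective g).comp Subtype.val_injective) (α g)
      fun h y => (hα.2.1 h g y).symm
  · obtain ⟨F, hcard, hF⟩ := hx U hU hxU n
    refine ⟨F.map (Function.Embedding.subtype _), by simpa using hcard, ?_⟩
    rw [Finset.coe_map]
    exact IsIndepSet.image Subtype.val_injective hF
end

section
/- Let H be a subgroup of a countably infinite discrete group G with [G:H] < +∞. If (X,H,α) is a topological dynamical system and (X_H^G, G, α^{H\G}) is the co-induced system, then for every k ∈ ℕ, IN_k(X_H^G, G) ⊆ ∏_{θ∈H\G} IN_k(X,H); that is, for every IN-tuple (f_1,…,f_k) of the co-induced system and every coset θ ∈ H\G, the tuple (f_1(θ),…,f_k(θ)) belongs to IN_k(X,H). -/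
open Filter Topology Set
open scoped ENNReal Classical

namespace CoInd

variable {G : Type*} [Group G] {H : Subgroup G}

theorem finite_RQ (hH : H.index ≠ 0) : Finite (RQ H) :=
  have : H.FiniteIndex := ⟨hH⟩
  Finite.of_equiv (G ⧸ H) (QuotientGroup.quotientRightRelEquivQuotientLeftRel H).symm

theorem rmul_eq_mk {s : RQ H → G} (hs : IsSection H s) (g : G) (θ : RQ H) :
    rmul H g θ = Quotient.mk'' (s θ * g) :=
  congrArg (rmul H g) (hs.1 θ).symm

/-- The element `s(θ)⁻¹ h s(θ')`; as `h` ranges over `H` these are exactly the elements of `G`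
carrying `θ` to `θ'`. -/
def transport (s : RQ H → G) (θ θ' : RQ H) (h : H) : G :=
  (s θ)⁻¹ * h * s θ'

theorem transport_injective (s : RQ H → G) (θ θ' : RQ H) :
    Function.Injective (transport s θ θ') := by
  intro a b hab
  simpa [transport] using hab

theorem rmul_transport {s : RQ H → G} (hs : IsSection H s) (θ θ' : RQ H) (h : H) :
    rmul H (transport s θ θ' h) θ = θ' := by
  rw [rmul_eq_mk hs]
  conv_rhs => rw [← hs.1 θ']
  rw [Quotient.eq'', QuotientGroup.rightRel_apply]
  have : s θ' * (s θ * transport s θ θ' h)⁻¹ = (h : G)⁻¹ := by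
    unfold transport; group
  rw [this]
  exact H.inv_mem h.2

theorem exists_transport_eq {s : RQ H → G} (hs : IsSection H s) {θ θ' : RQ H} {g : G}
    (hg : rmul H g θ = θ') : ∃ h : H, transport s θ θ' h = g := by
  have hmk : (Quotient.mk'' (s θ') : RQ H) = Quotient.mk'' (s θ * g) := by
    rw [hs.1, ← rmul_eq_mk hs, hg]
  rw [Quotient.eq'', QuotientGroup.rightRel_apply] at hmk
  refine ⟨⟨_, hmk⟩, ?_⟩
  simp only [transport]
  group

theorem coindAct_transport {X : Type*} (α : H → X → X) {s : RQ H → G} (hs : IsSection H s)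
    (θ θ' : RQ H) (h : H) (x : RQ H → X) :
    coindAct H α s (transport s θ θ' h) x θ = α h (x θ') := by
  have key : s θ * transport s θ θ' h * (s θ')⁻¹ = h := by
    unfold transport; group
  unfold coindAct
  simp only [rmul_transport hs, key, SetLike.coe_mem, dif_pos, Subtype.coe_eta]

/-- An independence set in `G` for the cylinder sets over `θ` pulls back along `transport` to an
independence set in `H`. -/
theorem isIndepSet_preimage_transport {X : Type*} {α : H → X → X} {s : RQ H → G}
    (hs : IsSection H s) {k : ℕ} {U : Fin k → Set X} {θ : RQ H} {I : Set G}
    (hI : IsIndepSet (coindAct H α s) (fun i => (fun x : RQ H → X => x θ) ⁻¹' U i) I)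
    (θ' : RQ H) :
    IsIndepSet α U (transport s θ θ' ⁻¹' I) := by
  intro J hJ hne ω
  have hinj := transport_injective s θ θ'
  obtain ⟨x, hx⟩ := hI (J.image (transport s θ θ')) (by simpa using hJ) (hne.image _)
    (ω ∘ Function.invFun (transport s θ θ'))
  refine ⟨x θ', mem_iInter₂.2 fun h hh => ?_⟩
  have hmem := mem_iInter₂.1 hx _ (Finset.mem_image_of_mem _ hh)
  simpa [Function.leftInverse_invFun hinj h, coindAct_transport α hs] using hmem

end CoInd

/-- Lemma 3.2: if `[G:H] < ∞`, every IN-tuple of the co-induced system is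
coordinatewise an IN-tuple of the `H`-system. -/
theorem coinduced_INTuples_subset_prod
    {G X : Type*} [Group G] [Countable G] [Infinite G] [MetricSpace X] [CompactSpace X]
    (H : Subgroup G) (hH : H.index ≠ 0) (α : ↥H → X → X) (hα : IsActionBy α)
    (s : CoInd.RQ H → G) (hs : CoInd.IsSection H s) (k : ℕ)
    (f : Fin k → (CoInd.RQ H → X)) (hf : IsINTuple (CoInd.coindAct H α s) f)
    (θ : CoInd.RQ H) :
    IsINTuple α (fun i => f i θ) := by
  intro U hU hfU n
  have := CoInd.finite_RQ hH
  have := Fintype.ofFinite (CoInd.RQ H)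
  obtain ⟨F, hcard, hF⟩ := hf (fun i => (fun x : CoInd.RQ H → X => x θ) ⁻¹' U i)
    (fun i => (hU i).preimage (continuous_apply θ)) hfU (Fintype.card (CoInd.RQ H) * n)
  obtain ⟨θ', -, hθ'⟩ := Finset.exists_le_card_fiber_of_mul_le_card_of_maps_to
    (f := fun g => CoInd.rmul H g θ) (t := Finset.univ)
    (fun _ _ => Finset.mem_univ _) ⟨θ, Finset.mem_univ θ⟩ hcard
  refine ⟨F.preimage (CoInd.transport s θ θ') (CoInd.transport_injective s θ θ').injOn,
    hθ'.trans ?_, ?_⟩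
  · refine (Finset.card_le_card fun g hg => ?_).trans
      (Finset.card_image_le (f := CoInd.transport s θ θ'))
    obtain ⟨hgF, hgθ⟩ := Finset.mem_filter.1 hg
    obtain ⟨h, rfl⟩ := CoInd.exists_transport_eq hs hgθ
    exact Finset.mem_image_of_mem _ (Finset.mem_preimage.2 hgF)
  · rw [Finset.coe_preimage]
    exact CoInd.isIndepSet_preimage_transport hs hF θ'
end
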